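/- arXiv:1609.04125 — 2 statements merged into one kernel-verified Lean document; each statement's English description precedes it below -/
import Mathlib

section
/- Let I be an open interval containing [0,1] and let f : ℝ → ℝ be twice differentiable on I with a bounded second derivative on I and satisfy f(x) > 2 for all x ∈ I. Fix ε ∈ ℝ. Then lim_{n→∞} det T_n(f;ε)/G(f)^n = (f(0) + √(f(0)² − 4))^{1−ε} · (f(1) + √(f(1)² − 4))^{ε} / (2 · ((f(0)² − 4)(f(1)² − 4))^{1/4}). -/
open Filter Topology

/-- The n×n shifted discrete Schrödinger matrix T_n(f;ε) with diagonal entries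
f((j−1+ε)/n) for j = 1,…,n and −1 on the first super- and subdiagonals. -/
noncomputable def TmatShift (f : ℝ → ℝ) (ε : ℝ) (n : ℕ) : Matrix (Fin n) (Fin n) ℝ :=
  Matrix.of fun i j =>
    if (i : ℕ) = (j : ℕ) then f (((i : ℕ) + ε : ℝ) / (n : ℝ))
    else if (i : ℕ) + 1 = (j : ℕ) ∨ (j : ℕ) + 1 = (i : ℕ) then -1 else 0

/-- G(f) = exp ∫₀¹ log((f(x) + √(f(x)² − 4))/2) dx. -/
noncomputable def Gf (f : ℝ → ℝ) : ℝ :=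
  Real.exp (∫ x in (0:ℝ)..1, Real.log ((f x + Real.sqrt (f x ^ 2 - 4)) / 2))

/-- The determinant of the tridiagonal matrix with diagonal `F` and off-diagonal entries `-1`,
given by its three-term recurrence. -/
noncomputable def continuant (F : ℕ → ℝ) : ℕ → ℝ
  | 0 => 1
  | 1 => F 0
  | k + 2 => F (k + 1) * continuant F (k + 1) - continuant F k

/-- The Riccati recursion `r (k + 1) = F (k + 1) - 1 / r k` started at `r₀`. -/
noncomputable def riccati (F : ℕ → ℝ) (r₀ : ℝ) : ℕ → ℝ
  | 0 => r₀
  | k + 1 => F (k + 1) - 1 / riccati F r₀ k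

theorem det_tridiagonal (F : ℕ → ℝ) (m : ℕ) :
    (Matrix.of fun i j : Fin m =>
      if (i : ℕ) = (j : ℕ) then F i
      else if (i : ℕ) + 1 = (j : ℕ) ∨ (j : ℕ) + 1 = (i : ℕ) then (-1 : ℝ) else 0).det =
    continuant F m := by
  induction m using Nat.twoStepInduction with
  | zero => simp [continuant]
  | one => simp [continuant]
  | more m ih ih' =>
    rw [Matrix.det_succ_row _ (Fin.last (m + 1)), Fin.sum_univ_castSucc, Fin.sum_univ_castSucc,
      Finset.sum_eq_zero]
    · have hminor : ((Matrix.of fun i j : Fin (m + 2) =>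
          if (i : ℕ) = (j : ℕ) then F i
          else if (i : ℕ) + 1 = (j : ℕ) ∨ (j : ℕ) + 1 = (i : ℕ) then (-1 : ℝ) else 0).submatrix
          (Fin.last (m + 1)).succAbove (Fin.last m).castSucc.succAbove).det
          = -continuant F m := by
        rw [Matrix.det_succ_column _ (Fin.last m), Fin.sum_univ_castSucc, Finset.sum_eq_zero]
        · rw [← ih]
          simp only [Matrix.submatrix_apply, Matrix.of_apply, Matrix.submatrix_submatrix]
          simp only [Fin.succAbove_last, Fin.succAbove_castSucc_self]
          simp only [Fin.val_last, Fin.val_castSucc, Fin.succ_last]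
          rw [if_neg (by omega), if_pos (by simp), Even.neg_one_pow ⟨m, rfl⟩]
          simp only [one_mul, zero_add, neg_mul]
          congr 2
          ext i j
          have : ((Fin.last m).castSucc.succAbove j.castSucc : Fin (m+2)) = j.castSucc.castSucc :=
            Fin.succAbove_of_castSucc_lt _ _ (by simp [Fin.lt_def])
          simp [this]
        · intro i _
          simp only [Matrix.submatrix_apply, Matrix.of_apply]
          simp only [Fin.succAbove_last, Fin.succAbove_castSucc_self]
          have := i.2
          simp only [Fin.val_last, Fin.val_castSucc, Fin.succ_last]
          rw [if_neg (by omega), if_neg (by omega)]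
          simp
      rw [hminor, continuant, ← ih']
      simp only [Matrix.of_apply, Fin.val_last, Fin.val_castSucc, Fin.succAbove_last]
      rw [if_neg (by omega), if_pos (by simp), if_pos trivial, Even.neg_one_pow ⟨m + 1, rfl⟩,
        Odd.neg_one_pow ⟨m, by ring⟩]
      have hsub : ((Matrix.of fun i j : Fin (m + 2) =>
          if (i : ℕ) = (j : ℕ) then F i
          else if (i : ℕ) + 1 = (j : ℕ) ∨ (j : ℕ) + 1 = (i : ℕ) then (-1 : ℝ) else 0).submatrix
          Fin.castSucc Fin.castSucc) = (Matrix.of fun i j : Fin (m + 1) =>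
          if (i : ℕ) = (j : ℕ) then F i
          else if (i : ℕ) + 1 = (j : ℕ) ∨ (j : ℕ) + 1 = (i : ℕ) then (-1 : ℝ) else 0) := by
        ext i j
        simp
      rw [hsub]
      ring
    · intro i _
      have := i.2
      simp only [Matrix.of_apply, Fin.val_last, Fin.val_castSucc]
      rw [if_neg (by omega), if_neg (by omega)]
      simp

/-- The Casoratian of two solutions of the same three-term recurrence is constant. -/
theorem continuant_casoratian {F : ℕ → ℝ} {r₀ : ℝ} {m : ℕ}
    (hr : ∀ k < m, 0 < riccati F r₀ k) (k : ℕ) (hk : k < m) :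
    continuant F (k + 1) * ∏ j ∈ Finset.range k, riccati F r₀ j
      - continuant F k * ∏ j ∈ Finset.range (k + 1), riccati F r₀ j = F 0 - r₀ := by
  induction k with
  | zero => simp [continuant, riccati]
  | succ k ih =>
    rw [← ih (by omega), continuant, Finset.prod_range_succ _ (k + 1), Finset.prod_range_succ _ k,
      riccati]
    have := (hr k (by omega)).ne'
    field_simp
    ring

theorem continuant_eq_prod_mul {F : ℕ → ℝ} {r₀ : ℝ} {m : ℕ}
    (hr : ∀ k < m, 0 < riccati F r₀ k) :
    continuant F m = (∏ j ∈ Finset.range m, riccati F r₀ j) *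
      (1 + ∑ k ∈ Finset.range m, (F 0 - r₀) /
        ((∏ j ∈ Finset.range k, riccati F r₀ j) * ∏ j ∈ Finset.range (k + 1), riccati F r₀ j)) := by
  induction m with
  | zero => simp [continuant]
  | succ m ih =>
    have hpos : ∀ k ≤ m + 1, 0 < ∏ j ∈ Finset.range k, riccati F r₀ j := fun k hk =>
      Finset.prod_pos fun j hj => hr j (by have := Finset.mem_range.1 hj; omega)
    have hW := continuant_casoratian hr m (by omega)
    have h1 := (hpos m (by omega)).ne'
    have h2 := (hpos (m + 1) le_rfl).ne'
    have ih := ih fun k hk => hr k (by omega)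
    rw [Finset.sum_range_succ, ← add_assoc, mul_add]
    have : (1 + ∑ k ∈ Finset.range m, (F 0 - r₀) /
        ((∏ j ∈ Finset.range k, riccati F r₀ j) * ∏ j ∈ Finset.range (k + 1), riccati F r₀ j))
        = continuant F m / ∏ j ∈ Finset.range m, riccati F r₀ j := by
      rw [ih]; field_simp
    rw [this, ← hW]
    field_simp
    ring

/-- An approximate solution of the Riccati recursion stays close to the exact one. -/
theorem abs_riccati_sub_le {F R : ℕ → ℝ} {p B η : ℝ} {N : ℕ} (hp : 1 < p)
    (hR : ∀ k < N, p ≤ R k) (hB₀ : 0 ≤ B) (hB : B ≤ (p - 1) / 2) (hη : η + B / p ≤ B)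
    (hE : ∀ k, k + 1 < N → |R (k + 1) + 1 / R k - F (k + 1)| ≤ η) (k : ℕ) (hk : k < N) :
    |riccati F (R 0) k - R k| ≤ B := by
  induction k with
  | zero => simpa [riccati] using hB₀
  | succ k ih =>
    have ih := ih (by omega)
    have hRk := hR k (by omega)
    have hr : 1 ≤ riccati F (R 0) k := by linarith [(abs_le.1 ih).1]
    have hmul : p ≤ riccati F (R 0) k * R k := by nlinarith
    have hinv : |1 / riccati F (R 0) k - 1 / R k| ≤ B / p := by
      rw [div_sub_div _ _ (by linarith) (by linarith), abs_div, one_mul, mul_one, abs_sub_comm,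
        abs_of_pos (by linarith : 0 < riccati F (R 0) k * R k)]
      exact div_le_div₀ hB₀ ih (by linarith) hmul
    have hE := hE k hk
    rw [riccati]
    have : F (k + 1) - 1 / riccati F (R 0) k - R (k + 1)
      = -(R (k + 1) + 1 / R k - F (k + 1)) - (1 / riccati F (R 0) k - 1 / R k) := by ring
    rw [this]
    refine (abs_sub _ _).trans ?_
    rw [abs_neg]
    linarith

theorem tendsto_continuant_div_prod {F : ℕ → ℕ → ℝ} {r₀ : ℕ → ℝ} {p l : ℝ} (hp : 1 < p)
    (hl : 1 < l) (hr : ∀ᶠ n in atTop, ∀ k < n, p ≤ riccati (F n) (r₀ n) k)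
    (hlim : ∀ k, Tendsto (fun n => riccati (F n) (r₀ n) k) atTop (𝓝 l))
    (hF : Tendsto (fun n => F n 0) atTop (𝓝 (l + 1 / l))) :
    Tendsto (fun n => continuant (F n) n / ∏ j ∈ Finset.range n, riccati (F n) (r₀ n) j) atTop
      (𝓝 (1 / (1 - (1 / l) ^ 2))) := by
  have hprod : ∀ k, Tendsto (fun n => ∏ j ∈ Finset.range k, riccati (F n) (r₀ n) j) atTop
      (𝓝 (l ^ k)) := fun k => by
    simpa using tendsto_finsetProd (Finset.range k) fun j _ => hlim j
  have hF0 : Tendsto (fun n => F n 0 - r₀ n) atTop (𝓝 (1 / l)) := by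
    simpa [riccati] using hF.sub (hlim 0)
  have hsum : Tendsto (fun n => ∑' k, if k < n then (F n 0 - r₀ n) /
      ((∏ j ∈ Finset.range k, riccati (F n) (r₀ n) j) *
        ∏ j ∈ Finset.range (k + 1), riccati (F n) (r₀ n) j) else 0) atTop
      (𝓝 (∑' k : ℕ, (1 / l) / (l ^ k * l ^ (k + 1)))) := by
    refine tendsto_tsum_of_dominated_convergence
      (bound := fun k => (1 / l + 1) * (1 / p) ^ k) ?_ ?_ ?_
    · exact (summable_geometric_of_lt_one (by positivity)
        (by rw [div_lt_one (by linarith)]; exact hp)).mul_left _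
    · intro k
      refine (hF0.div ((hprod k).mul (hprod (k + 1))) (by positivity)).congr' ?_
      filter_upwards [eventually_gt_atTop k] with n hn
      simp [hn]
    · filter_upwards [hr, hF0.abs.eventually (eventually_le_nhds (b := 1 / l + 1)
        (by rw [abs_of_pos (by positivity)]; linarith))] with n hn hn' k
      split_ifs with hk
      · have hge : ∀ i ≤ n, p ^ i ≤ ∏ j ∈ Finset.range i, riccati (F n) (r₀ n) j := by
          intro i hi
          simpa using Finset.prod_le_prod (s := Finset.range i) (f := fun _ => p)
            (fun _ _ => by linarith)
            fun j hj => hn j (lt_of_lt_of_le (Finset.mem_range.1 hj) hi)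
        have h1 := hge k hk.le
        have h2 := (one_le_pow₀ hp.le).trans (hge (k + 1) hk)
        have hpk : 0 < p ^ k := by positivity
        rw [norm_div, Real.norm_eq_abs, Real.norm_of_nonneg (by nlinarith), one_div p, inv_pow,
          ← div_eq_mul_inv]
        exact div_le_div₀ (by positivity) hn' hpk (by nlinarith)
      · rw [norm_zero]; positivity
  have hval : 1 + ∑' k : ℕ, (1 / l) / (l ^ k * l ^ (k + 1)) = 1 / (1 - (1 / l) ^ 2) := by
    have hq : (1 / l) ^ 2 < 1 := by
      rw [div_pow, one_pow, div_lt_one (by positivity)]; nlinarith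
    have : ∀ k : ℕ, (1 / l) / (l ^ k * l ^ (k + 1)) = (1 / l) ^ 2 * ((1 / l) ^ 2) ^ k := by
      intro k
      simp only [div_pow, one_pow, ← pow_mul]
      field_simp
      ring
    simp_rw [this]
    rw [tsum_mul_left, tsum_geometric_of_lt_one (by positivity) hq]
    have := (sub_pos.2 hq).ne'
    rw [← div_eq_mul_inv, eq_div_iff this, add_mul, div_mul_cancel₀ _ this]
    ring
  rw [← hval]
  refine (hsum.const_add 1).congr' ?_
  filter_upwards [hr] with n hn
  have hpos : ∀ k < n, 0 < riccati (F n) (r₀ n) k := fun k hk => by linarith [hn k hk]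
  rw [continuant_eq_prod_mul hpos, mul_div_cancel_left₀ _
    (Finset.prod_pos fun j hj => hpos j (Finset.mem_range.1 hj)).ne',
    tsum_eq_sum (s := Finset.range n)]
  · congr 1
    exact Finset.sum_congr rfl fun k hk => by rw [if_pos (Finset.mem_range.1 hk)]
  · intro k hk
    rw [if_neg (by simpa using hk)]

theorem tendsto_prod_div_prod {r R : ℕ → ℕ → ℝ} {C : ℝ}
    (hR : ∀ᶠ n in atTop, ∀ k < n, 1 ≤ R n k)
    (h : ∀ᶠ n : ℕ in atTop, ∀ k < n, |r n k - R n k| ≤ C / (n : ℝ) ^ 2) :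
    Tendsto (fun n => (∏ k ∈ Finset.range n, r n k) / ∏ k ∈ Finset.range n, R n k) atTop
      (𝓝 1) := by
  rw [tendsto_iff_norm_sub_tendsto_zero]
  have hlim : Tendsto (fun n : ℕ => Real.exp (C / n) - 1) atTop (𝓝 0) := by
    have := (Real.continuous_exp.tendsto 0).comp (tendsto_const_div_atTop_nhds_zero_nat C)
    simpa using this.sub_const 1
  refine squeeze_zero' (Eventually.of_forall fun _ => norm_nonneg _) ?_ hlim
  filter_upwards [hR, h, eventually_gt_atTop 0] with n hR h hn
  rw [← Finset.prod_div_distrib]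
  have hrew : ∏ k ∈ Finset.range n, r n k / R n k
      = ∏ k ∈ Finset.range n, (1 + (r n k - R n k) / R n k) := by
    refine Finset.prod_congr rfl fun k hk => ?_
    have := hR k (Finset.mem_range.1 hk)
    field_simp
    ring
  rw [hrew]
  refine (Finset.norm_prod_one_add_sub_one_le _ _).trans ?_
  gcongr
  calc ∑ k ∈ Finset.range n, ‖(r n k - R n k) / R n k‖
      ≤ ∑ _k ∈ Finset.range n, C / (n : ℝ) ^ 2 := by
        refine Finset.sum_le_sum fun k hk => ?_
        have h1 := hR k (Finset.mem_range.1 hk)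
        rw [norm_div, Real.norm_eq_abs, Real.norm_of_nonneg (by linarith)]
        exact (div_le_self (abs_nonneg _) h1).trans (h k (Finset.mem_range.1 hk))
    _ = C / n := by
        rw [Finset.sum_const, Finset.card_range, nsmul_eq_mul]
        field_simp

/-- `φ` is Lipschitz on `s` and approximated to second order by its linearisation with slope
`φ'`. -/
def HasTaylorBound (φ φ' : ℝ → ℝ) (s : Set ℝ) (K : ℝ) : Prop :=
  (∀ x ∈ s, ∀ y ∈ s, |φ y - φ x| ≤ K * |y - x|) ∧
  ∀ x ∈ s, ∀ y ∈ s, |φ y - φ x - φ' x * (y - x)| ≤ K * (y - x) ^ 2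

theorem abs_sub_sub_deriv_mul_le {φ φ' φ'' : ℝ → ℝ} {s : Set ℝ} {M : ℝ} (hs : Convex ℝ s)
    (h1 : ∀ x ∈ s, HasDerivAt φ (φ' x) x) (h2 : ∀ x ∈ s, HasDerivAt φ' (φ'' x) x)
    (hM : ∀ x ∈ s, |φ'' x| ≤ M) {x y : ℝ} (hx : x ∈ s) (hy : y ∈ s) :
    |φ y - φ x - φ' x * (y - x)| ≤ M * (y - x) ^ 2 := by
  have hsub : Set.uIcc x y ⊆ s := hs.ordConnected.uIcc_subset hx hy
  have hM0 : 0 ≤ M := (abs_nonneg _).trans (hM x hx)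
  have hbound : ∀ z ∈ Set.uIcc x y, ‖φ' z - φ' x‖ ≤ M * |y - x| := by
    intro z hz
    have := hs.norm_image_sub_le_of_norm_hasDerivWithin_le
      (fun u hu => (h2 u hu).hasDerivWithinAt) hM hx (hsub hz)
    refine this.trans ?_
    gcongr
    exact Set.abs_sub_left_of_mem_uIcc hz
  have := (convex_uIcc x y).norm_image_sub_le_of_norm_hasDerivWithin_le
    (f := fun z => φ z - φ' x * z) (f' := fun z => φ' z - φ' x)
    (fun u hu => ((h1 u (hsub hu)).sub
      ((hasDerivAt_id u).const_mul (φ' x) |>.congr_deriv (mul_one _))).hasDerivWithinAt)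
    hbound Set.left_mem_uIcc Set.right_mem_uIcc
  rw [Real.norm_eq_abs, Real.norm_eq_abs, mul_assoc, abs_mul_abs_self] at this
  calc |φ y - φ x - φ' x * (y - x)| = |φ y - φ' x * y - (φ x - φ' x * x)| := by ring_nf
    _ ≤ _ := by rw [sq]; exact this

theorem exists_hasTaylorBound_comp {f f' f'' Φ : ℝ → ℝ} {c d M : ℝ} {U : Set ℝ} (hU : IsOpen U)
    (hΦ : ContDiffOn ℝ 2 Φ U) (hfU : ∀ x ∈ Set.Icc c d, f x ∈ U)
    (h1 : ∀ x ∈ Set.Icc c d, HasDerivAt f (f' x) x)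
    (h2 : ∀ x ∈ Set.Icc c d, HasDerivAt f' (f'' x) x)
    (hM : ∀ x ∈ Set.Icc c d, |f'' x| ≤ M) :
    ∃ K, 0 ≤ K ∧
      HasTaylorBound (fun x => Φ (f x)) (fun x => deriv Φ (f x) * f' x) (Set.Icc c d) K := by
  have hΦ' : ContDiffOn ℝ 1 (deriv Φ) U := ((contDiffOn_succ_iff_deriv_of_isOpen hU).1
    (show ContDiffOn ℝ (1 + 1) Φ U by norm_num; exact hΦ)).2.2
  have hd : ∀ t ∈ U, HasDerivAt Φ (deriv Φ t) t := fun t ht =>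
    ((hΦ.differentiableOn (by norm_num)).differentiableAt (hU.mem_nhds ht)).hasDerivAt
  have hd' : ∀ t ∈ U, HasDerivAt (deriv Φ) (deriv (deriv Φ) t) t := fun t ht =>
    ((hΦ'.differentiableOn (by norm_num)).differentiableAt (hU.mem_nhds ht)).hasDerivAt
  have hcont : ContinuousOn (deriv (deriv Φ)) U := hΦ'.continuousOn_deriv_of_isOpen hU le_rfl
  have hf : ContinuousOn f (Set.Icc c d) := fun x hx => (h1 x hx).continuousAt.continuousWithinAt
  have hf' : ContinuousOn f' (Set.Icc c d) := fun x hx => (h2 x hx).continuousAt.continuousWithinAt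
  obtain ⟨A, hA⟩ := isCompact_Icc.exists_bound_of_continuousOn hf'
  obtain ⟨B, hB⟩ := isCompact_Icc.exists_bound_of_continuousOn (hΦ'.continuousOn.comp hf hfU)
  obtain ⟨C, hC⟩ := isCompact_Icc.exists_bound_of_continuousOn (hcont.comp hf hfU)
  have e1 : ∀ x ∈ Set.Icc c d, HasDerivAt (fun x => Φ (f x)) (deriv Φ (f x) * f' x) x :=
    fun x hx => (hd _ (hfU x hx)).comp x (h1 x hx)
  have e2 : ∀ x ∈ Set.Icc c d, HasDerivAt (fun x => deriv Φ (f x) * f' x)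
      (deriv (deriv Φ) (f x) * f' x * f' x + deriv Φ (f x) * f'' x) x :=
    fun x hx => ((hd' _ (hfU x hx)).comp x (h1 x hx)).mul (h2 x hx)
  have b1 : ∀ x ∈ Set.Icc c d, ‖deriv Φ (f x) * f' x‖ ≤ |B| * |A| := fun x hx => by
    rw [norm_mul]
    exact mul_le_mul ((hB x hx).trans (le_abs_self _)) ((hA x hx).trans (le_abs_self _))
      (norm_nonneg _) (abs_nonneg _)
  have b2 : ∀ x ∈ Set.Icc c d, |deriv (deriv Φ) (f x) * f' x * f' x + deriv Φ (f x) * f'' x|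
      ≤ |C| * |A| * |A| + |B| * |M| := fun x hx => by
    refine (abs_add_le _ _).trans ?_
    rw [abs_mul, abs_mul, abs_mul]
    have hA' := (hA x hx).trans (le_abs_self _)
    have hB' := (hB x hx).trans (le_abs_self _)
    have hC' := (hC x hx).trans (le_abs_self _)
    have hM' := (hM x hx).trans (le_abs_self _)
    simp only [Real.norm_eq_abs, Function.comp_apply] at hA' hB' hC'
    gcongr
  refine ⟨max (|B| * |A|) (|C| * |A| * |A| + |B| * |M|), by positivity, ?_, ?_⟩
  · intro x hx y hy
    refine ((convex_Icc c d).norm_image_sub_le_of_norm_hasDerivWithin_le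
      (fun u hu => (e1 u hu).hasDerivWithinAt) b1 hx hy).trans ?_
    rw [Real.norm_eq_abs]
    gcongr
    exact le_max_left _ _
  · intro x hx y hy
    refine (abs_sub_sub_deriv_mul_le (convex_Icc c d) e1 e2 b2 hx hy).trans ?_
    gcongr
    exact le_max_right _ _

/-- Shifted Riemann sums of a function with a second-order Taylor bound. -/
theorem tendsto_sum_sub_integral {φ φ' : ℝ → ℝ} {s : Set ℝ} {K : ℝ} (ε : ℝ)
    (hφ : HasTaylorBound φ φ' s K) (hs : Set.Icc (0 : ℝ) 1 ⊆ s)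
    (hmem : ∀ᶠ n : ℕ in atTop, ∀ k ≤ n, ((k : ℝ) + ε) / n ∈ s) :
    Tendsto (fun n : ℕ => ∑ k ∈ Finset.range n, φ (((k : ℝ) + ε) / n) - n * ∫ x in (0 : ℝ)..1, φ x)
      atTop (𝓝 ((ε - 1 / 2) * (φ 1 - φ 0))) := by
  obtain ⟨hlip, htay⟩ := hφ
  have hK : 0 ≤ K := by
    have := hlip 0 (hs (by simp)) 1 (hs (by simp))
    simp only [sub_zero, abs_one, mul_one] at this
    exact (abs_nonneg _).trans this
  have hcont : ContinuousOn φ (Set.Icc 0 1) :=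
    (LipschitzOnWith.of_dist_le_mul (K := ⟨K, hK⟩) fun x hx y hy => by
      rw [dist_comm, Real.dist_eq, dist_comm, Real.dist_eq]
      exact hlip x (hs hx) y (hs hy)).continuousOn
  rw [tendsto_iff_norm_sub_tendsto_zero]
  refine squeeze_zero' (Eventually.of_forall fun _ => norm_nonneg _) ?_
    (tendsto_const_div_atTop_nhds_zero_nat (K * (ε ^ 2 + 1 + |ε - 1 / 2|)))
  filter_upwards [hmem, eventually_gt_atTop 0] with n hmem hn
  have hn' : (0 : ℝ) < n := by exact_mod_cast hn
  have hgrid : ∀ k ≤ n, (k : ℝ) / n ∈ Set.Icc (0 : ℝ) 1 := fun k hk =>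
    ⟨by positivity, by rw [div_le_one hn']; exact_mod_cast hk⟩
  have hcell : ∀ k < n, Set.uIcc ((k : ℝ) / n) ((k + 1 : ℕ) / n) ⊆ Set.Icc (0 : ℝ) 1 :=
    fun k hk => Set.ordConnected_Icc.uIcc_subset (hgrid k hk.le) (hgrid (k + 1) hk)
  have hint : ∀ k < n, IntervalIntegrable φ MeasureTheory.volume ((k : ℝ) / n) ((k + 1 : ℕ) / n) :=
    fun k hk => (hcont.mono (hcell k hk)).intervalIntegrable
  have hsplit : ∫ x in (0 : ℝ)..1, φ x
      = ∑ k ∈ Finset.range n, ∫ x in ((k : ℝ) / n)..((k + 1 : ℕ) / n), φ x := by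
    rw [intervalIntegral.sum_integral_adjacent_intervals (a := fun k : ℕ => (k : ℝ) / n) hint]
    simp [hn'.ne']
  have htele : φ 1 - φ 0 = ∑ k ∈ Finset.range n, (φ ((k + 1 : ℕ) / n) - φ ((k : ℝ) / n)) := by
    rw [Finset.sum_range_sub (fun k : ℕ => φ ((k : ℝ) / n))]
    simp [hn'.ne']
  rw [hsplit, htele, Finset.mul_sum, Finset.mul_sum, ← Finset.sum_sub_distrib,
    ← Finset.sum_sub_distrib]
  have hterm : ∀ k ∈ Finset.range n, ‖φ (((k : ℝ) + ε) / n)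
      - n * (∫ x in ((k : ℝ) / n)..((k + 1 : ℕ) / n), φ x)
      - (ε - 1 / 2) * (φ ((k + 1 : ℕ) / n) - φ ((k : ℝ) / n))‖
      ≤ K * (ε ^ 2 + 1 + |ε - 1 / 2|) / (n : ℝ) ^ 2 := by
    intro k hk
    have hk := Finset.mem_range.1 hk
    set u : ℝ := (k : ℝ) / n with hu
    have hu1 : ((k + 1 : ℕ) : ℝ) / n = u + 1 / n := by rw [hu]; push_cast; ring
    have hue : ((k : ℝ) + ε) / n = u + ε / n := by rw [hu]; ring
    have hint := hint k hk
    have hcell := hcell k hk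
    have hm := hmem k hk.le
    rw [hue] at hm
    have hus := hs (hgrid k hk.le)
    have hvs := hs (hgrid (k + 1) hk)
    rw [← hu] at hus
    rw [hu1] at hint hcell hvs
    rw [hu1, hue]
    have t1 := htay u hus _ hm
    have t2 := htay u hus _ hvs
    rw [add_sub_cancel_left] at t1 t2
    have t3 : |∫ x in u..(u + 1 / n), (φ x - φ u - φ' u * (x - u))|
        ≤ K * (1 / n) ^ 2 * |u + 1 / n - u| := by
      rw [← Real.norm_eq_abs]
      refine intervalIntegral.norm_integral_le_of_norm_le_const fun x hx => ?_
      have hx' := Set.uIoc_subset_uIcc hx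
      refine (htay u hus x (hs (hcell hx'))).trans ?_
      gcongr K * ?_
      rw [sq_le_sq]
      have := Set.abs_sub_left_of_mem_uIcc hx'
      rwa [add_sub_cancel_left] at this
    have hI : ∫ x in u..(u + 1 / n), (φ x - φ u - φ' u * (x - u))
        = (∫ x in u..(u + 1 / n), φ x) - φ u * (1 / n) - φ' u * ((1 / n) ^ 2 / 2) := by
      have i1 : IntervalIntegrable (fun _ : ℝ => φ u) MeasureTheory.volume u (u + 1 / n) :=
        intervalIntegrable_const
      have i2 : IntervalIntegrable (fun x : ℝ => φ' u * (x - u)) MeasureTheory.volume u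
          (u + 1 / n) := Continuous.intervalIntegrable (by fun_prop) _ _
      rw [intervalIntegral.integral_sub (hint.sub i1) i2, intervalIntegral.integral_sub hint i1,
        intervalIntegral.integral_const, intervalIntegral.integral_const_mul,
        intervalIntegral.integral_comp_sub_right (fun x => x) u]
      simp
      ring
    rw [hI, add_sub_cancel_left, abs_of_pos (by positivity : (0 : ℝ) < 1 / n)] at t3
    set I := ∫ x in u..(u + 1 / n), φ x
    have key : φ (u + ε / n) - n * I - (ε - 1 / 2) * (φ (u + 1 / n) - φ u)
        = (φ (u + ε / n) - φ u - φ' u * (ε / n))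
          - n * (I - φ u * (1 / n) - φ' u * ((1 / n) ^ 2 / 2))
          - (ε - 1 / 2) * (φ (u + 1 / n) - φ u - φ' u * (1 / n)) := by
      field_simp
      ring
    rw [Real.norm_eq_abs, key]
    refine (abs_sub _ _).trans ((add_le_add_left (abs_sub _ _) _).trans ?_)
    rw [abs_mul, abs_mul, abs_of_pos hn']
    calc _ ≤ K * (ε / n) ^ 2 + n * (K * (1 / n) ^ 2 * (1 / n))
          + |ε - 1 / 2| * (K * (1 / n) ^ 2) := by gcongr
      _ = _ := by field_simp
  refine (norm_sum_le_of_le _ hterm).trans_eq ?_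
  rw [Finset.sum_const, Finset.card_range, nsmul_eq_mul]
  field_simp

/-- The larger root of `z + z⁻¹ = t`. -/
noncomputable def growthRate (t : ℝ) : ℝ := (t + √(t ^ 2 - 4)) / 2

/-- The amplitude `(1 - growthRate t ^ (-2)) ^ (-1/2)` of the WKB approximation. -/
noncomputable def wkbAmplitude (t : ℝ) : ℝ := (√(1 - (growthRate t)⁻¹ ^ 2))⁻¹

theorem half_le_growthRate (t : ℝ) : t / 2 ≤ growthRate t := by
  have := Real.sqrt_nonneg (t ^ 2 - 4)
  rw [growthRate]
  linarith

theorem one_lt_growthRate {t : ℝ} (ht : 2 < t) : 1 < growthRate t := by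
  linarith [half_le_growthRate t]

theorem growthRate_mul {t : ℝ} (ht : 2 < t) : growthRate t * ((t - √(t ^ 2 - 4)) / 2) = 1 := by
  have := Real.sq_sqrt (show 0 ≤ t ^ 2 - 4 by nlinarith)
  rw [growthRate]
  linarith

theorem growthRate_add_inv {t : ℝ} (ht : 2 < t) : growthRate t + (growthRate t)⁻¹ = t := by
  rw [inv_eq_of_mul_eq_one_right (growthRate_mul ht), growthRate]
  ring

theorem growthRate_le {t : ℝ} (ht : 2 < t) : growthRate t ≤ t := by
  have := inv_pos.2 (zero_lt_one.trans (one_lt_growthRate ht))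
  linarith [growthRate_add_inv ht]

theorem contDiffAt_growthRate {t : ℝ} (ht : 2 < t) : ContDiffAt ℝ 2 growthRate t := by
  have h : t ^ 2 - 4 ≠ 0 := by nlinarith
  unfold growthRate
  fun_prop (disch := assumption)

theorem inv_growthRate_sq_lt_one {t : ℝ} (ht : 2 < t) : (growthRate t)⁻¹ ^ 2 < 1 := by
  have h := one_lt_growthRate ht
  exact pow_lt_one₀ (by positivity) (inv_lt_one_of_one_lt₀ h) two_ne_zero

theorem one_le_wkbAmplitude {t : ℝ} (ht : 2 < t) : 1 ≤ wkbAmplitude t := by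
  have h := inv_growthRate_sq_lt_one ht
  refine (one_le_inv₀ (Real.sqrt_pos.2 (by linarith))).2 ?_
  rw [Real.sqrt_le_one]
  linarith [sq_nonneg (growthRate t)⁻¹]

theorem contDiffAt_wkbAmplitude {t : ℝ} (ht : 2 < t) : ContDiffAt ℝ 2 wkbAmplitude t := by
  have h := inv_growthRate_sq_lt_one ht
  have hg := contDiffAt_growthRate ht
  have h0 : growthRate t ≠ 0 := by linarith [one_lt_growthRate ht]
  have h1 : 1 - (growthRate t)⁻¹ ^ 2 ≠ 0 := by linarith
  have h2 : √(1 - (growthRate t)⁻¹ ^ 2) ≠ 0 := (Real.sqrt_pos.2 (by linarith)).ne'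
  exact ((contDiffAt_const.sub ((hg.inv h0).pow 2)).sqrt h1).inv h2

/-- The transport equation, which makes the first-order term of the WKB residual vanish. -/
theorem deriv_inv_growthRate_mul_wkbAmplitude {t : ℝ} (ht : 2 < t) :
    deriv (fun t => (growthRate t)⁻¹ * wkbAmplitude t) t
      = growthRate t * deriv wkbAmplitude t := by
  have h := inv_growthRate_sq_lt_one ht
  have h0 : growthRate t ≠ 0 := by linarith [one_lt_growthRate ht]
  have h2 : √(1 - (growthRate t)⁻¹ ^ 2) ≠ 0 := (Real.sqrt_pos.2 (by linarith)).ne'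
  have hsq := Real.sq_sqrt (show 0 ≤ 1 - (growthRate t)⁻¹ ^ 2 by linarith)
  obtain ⟨m', hm⟩ : ∃ m', HasDerivAt (fun t => (growthRate t)⁻¹) m' t :=
    ⟨_, (((contDiffAt_growthRate ht).inv h0).differentiableAt (by norm_num)).hasDerivAt⟩
  have hA : HasDerivAt wkbAmplitude _ t :=
    (((hm.fun_pow 2).const_sub 1).sqrt (by linarith)).fun_inv h2
  rw [hA.deriv]
  refine (hm.fun_mul hA).deriv.trans ?_
  rw [wkbAmplitude]
  generalize √(1 - (growthRate t)⁻¹ ^ 2) = S at h2 hsq ⊢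
  have hl : (growthRate t)⁻¹ * growthRate t = 1 := inv_mul_cancel₀ h0
  generalize (growthRate t)⁻¹ = m at hl hsq ⊢
  generalize growthRate t = l at hl ⊢
  field_simp
  simp only [Nat.cast_ofNat, Nat.add_one_sub_one, pow_one]
  linear_combination 2 * m' * hsq - 2 * m' * hl

theorem prod_range_mul_div (a G : ℕ → ℝ) (n : ℕ) (hG : ∀ k ≤ n, G k ≠ 0) :
    ∏ k ∈ Finset.range n, a k * (G (k + 1) / G k)
      = (∏ k ∈ Finset.range n, a k) * (G n / G 0) := by
  induction n with
  | zero => simp [hG 0 le_rfl]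
  | succ n ih =>
    rw [Finset.prod_range_succ, Finset.prod_range_succ, ih fun k hk => hG k (by omega)]
    have := hG n (by omega)
    have := hG 0 (by omega)
    field_simp

theorem kac_limit_eq {s t : ℝ} (hs : 2 < s) (ht : 2 < t) (ε : ℝ) :
    1 / (1 - (1 / growthRate s) ^ 2) *
      (Real.exp ((ε - 1 / 2) * (Real.log (growthRate t) - Real.log (growthRate s))) *
        (wkbAmplitude t / wkbAmplitude s))
    = (s + √(s ^ 2 - 4)) ^ (1 - ε) * (t + √(t ^ 2 - 4)) ^ ε /
        (2 * ((s ^ 2 - 4) * (t ^ 2 - 4)) ^ ((1 : ℝ) / 4)) := by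
  have key : ∀ {u : ℝ}, 2 < u → u ^ 2 - 4 =
      (growthRate u ^ ((1 : ℝ) / 2) * √(1 - (growthRate u)⁻¹ ^ 2)) ^ 4 := by
    intro u hu
    have h0 := zero_lt_one.trans (one_lt_growthRate hu)
    have hS := Real.sq_sqrt (show 0 ≤ 1 - (growthRate u)⁻¹ ^ 2 by
      linarith [inv_growthRate_sq_lt_one hu])
    have hq : (growthRate u ^ ((1 : ℝ) / 2)) ^ 2 = growthRate u := by
      rw [← Real.sqrt_eq_rpow, Real.sq_sqrt h0.le]
    calc u ^ 2 - 4 = (growthRate u + (growthRate u)⁻¹) ^ 2 - 4 := by rw [growthRate_add_inv hu]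
      _ = ((growthRate u ^ ((1 : ℝ) / 2)) ^ 2 * √(1 - (growthRate u)⁻¹ ^ 2) ^ 2) ^ 2 := by
        rw [hS, hq]
        field_simp
        ring
      _ = _ := by ring
  have h2 : ∀ u : ℝ, u + √(u ^ 2 - 4) = 2 * growthRate u := fun u => by rw [growthRate]; ring
  have ls := zero_lt_one.trans (one_lt_growthRate hs)
  have lt := zero_lt_one.trans (one_lt_growthRate ht)
  have As := Real.sqrt_pos.2 (sub_pos.2 (inv_growthRate_sq_lt_one hs))
  have At := Real.sqrt_pos.2 (sub_pos.2 (inv_growthRate_sq_lt_one ht))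
  have hAs := Real.sq_sqrt (sub_pos.2 (inv_growthRate_sq_lt_one hs)).le
  have hexp : Real.exp ((ε - 1 / 2) * (Real.log (growthRate t) - Real.log (growthRate s)))
      = growthRate t ^ (ε - 1 / 2) * growthRate s ^ (1 / 2 - ε) := by
    rw [Real.rpow_def_of_pos lt, Real.rpow_def_of_pos ls, ← Real.exp_add]
    congr 1
    ring
  have e1 : (s + √(s ^ 2 - 4)) ^ (1 - ε) * (t + √(t ^ 2 - 4)) ^ ε
      = 2 * (growthRate s ^ (1 / 2 - ε) * growthRate s ^ ((1 : ℝ) / 2)) *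
        (growthRate t ^ (ε - 1 / 2) * growthRate t ^ ((1 : ℝ) / 2)) := by
    rw [h2, h2, Real.mul_rpow two_pos.le ls.le, Real.mul_rpow two_pos.le lt.le,
      ← Real.rpow_add ls, ← Real.rpow_add lt]
    have : (2 : ℝ) ^ (1 - ε) * 2 ^ ε = 2 := by rw [← Real.rpow_add two_pos]; simp
    rw [show 1 / 2 - ε + 1 / 2 = 1 - ε by ring, show ε - 1 / 2 + 1 / 2 = ε by ring]
    linear_combination growthRate s ^ (1 - ε) * growthRate t ^ ε * this
  have e2 : ((s ^ 2 - 4) * (t ^ 2 - 4)) ^ ((1 : ℝ) / 4)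
      = growthRate s ^ ((1 : ℝ) / 2) * √(1 - (growthRate s)⁻¹ ^ 2) *
        (growthRate t ^ ((1 : ℝ) / 2) * √(1 - (growthRate t)⁻¹ ^ 2)) := by
    rw [key hs, key ht, ← mul_pow, show (1 : ℝ) / 4 = ((4 : ℕ) : ℝ)⁻¹ by norm_num]
    exact Real.pow_rpow_inv_natCast (by positivity) (by norm_num)
  rw [e1, e2, hexp, one_div (growthRate s), wkbAmplitude, wkbAmplitude]
  generalize √(1 - (growthRate s)⁻¹ ^ 2) = A at As hAs ⊢
  rw [← hAs]
  have := Real.rpow_pos_of_pos ls (1 / 2)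
  have := Real.rpow_pos_of_pos lt (1 / 2)
  field_simp

/-- The WKB ratios solve the Riccati recursion up to an error of second order in the step. -/
theorem abs_wkb_residual_le {f f' : ℝ → ℝ} {s : Set ℝ} {K K' L x h : ℝ}
    (hf : ∀ x ∈ s, 2 < f x) (hL : ∀ x ∈ s, growthRate (f x) ≤ L)
    (hg : HasTaylorBound (fun x => wkbAmplitude (f x)) (fun x => deriv wkbAmplitude (f x) * f' x)
      s K)
    (hw : HasTaylorBound (fun x => (growthRate (f x))⁻¹ * wkbAmplitude (f x))
      (fun x => deriv (fun t => (growthRate t)⁻¹ * wkbAmplitude t) (f x) * f' x) s K')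
    (h₀ : x - h ∈ s) (h₁ : x ∈ s) (h₂ : x + h ∈ s) :
    |growthRate (f x) * (wkbAmplitude (f (x + h)) / wkbAmplitude (f x))
      + 1 / (growthRate (f (x - h)) * (wkbAmplitude (f x) / wkbAmplitude (f (x - h)))) - f x|
      ≤ (L * K + K') * h ^ 2 := by
  have t1 := hg.2 x h₁ _ h₂
  have t2 := hw.2 x h₁ _ h₀
  simp only at t1 t2
  rw [deriv_inv_growthRate_mul_wkbAmplitude (hf x h₁)] at t2
  have l0 := one_lt_growthRate (hf _ h₀)
  have l1 := one_lt_growthRate (hf _ h₁)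
  have g0 := one_le_wkbAmplitude (hf _ h₀)
  have g1 := one_le_wkbAmplitude (hf _ h₁)
  have hfx := growthRate_add_inv (hf _ h₁)
  have hLx := hL x h₁
  rw [show x + h - x = h by ring] at t1
  rw [show x - h - x = -h by ring, neg_sq] at t2
  set E := growthRate (f x) * (wkbAmplitude (f (x + h)) - wkbAmplitude (f x)
      - deriv wkbAmplitude (f x) * f' x * h)
    + ((growthRate (f (x - h)))⁻¹ * wkbAmplitude (f (x - h))
      - (growthRate (f x))⁻¹ * wkbAmplitude (f x)
      - growthRate (f x) * deriv wkbAmplitude (f x) * f' x * -h) with hE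
  have hEq : growthRate (f x) * (wkbAmplitude (f (x + h)) / wkbAmplitude (f x))
      + 1 / (growthRate (f (x - h)) * (wkbAmplitude (f x) / wkbAmplitude (f (x - h)))) - f x
      = E / wkbAmplitude (f x) := by
    have alg : ∀ {l l₀ g g₀ g₂ y d : ℝ}, 1 < l → 1 < l₀ → 1 ≤ g → 1 ≤ g₀ → l + l⁻¹ = y →
        l * (g₂ / g) + 1 / (l₀ * (g / g₀)) - y =
          (l * (g₂ - g - d * h) + (l₀⁻¹ * g₀ - l⁻¹ * g - l * d * -h)) / g := by
      rintro l l₀ g g₀ g₂ y d hl hl₀ hg hg₀ rfl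
      field_simp
      ring
    rw [alg l1 l0 g1 g0 hfx (d := deriv wkbAmplitude (f x) * f' x), hE, ← mul_assoc]
  rw [hEq, abs_div, abs_of_pos (by linarith : 0 < wkbAmplitude (f x))]
  refine (div_le_self (abs_nonneg _) g1).trans ((abs_add_le _ _).trans ?_)
  rw [abs_mul, abs_of_pos (by linarith : 0 < growthRate (f x))]
  linarith [mul_le_mul hLx t1 (abs_nonneg _) (by linarith)]

theorem kac_formula_shifted (a b : ℝ) (hI : Set.Icc (0:ℝ) 1 ⊆ Set.Ioo a b)
    (f f' f'' : ℝ → ℝ)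
    (hd1 : ∀ x ∈ Set.Ioo a b, HasDerivAt f (f' x) x)
    (hd2 : ∀ x ∈ Set.Ioo a b, HasDerivAt f' (f'' x) x)
    (hbd : ∃ M : ℝ, ∀ x ∈ Set.Ioo a b, |f'' x| ≤ M)
    (hf2 : ∀ x ∈ Set.Ioo a b, 2 < f x)
    (ε : ℝ) :
    Tendsto (fun n : ℕ => (TmatShift f ε n).det / (Gf f) ^ n) atTop
      (𝓝 ((f 0 + Real.sqrt (f 0 ^ 2 - 4)) ^ ((1:ℝ) - ε) *
          (f 1 + Real.sqrt (f 1 ^ 2 - 4)) ^ ε /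
          (2 * ((f 0 ^ 2 - 4) * (f 1 ^ 2 - 4)) ^ ((1:ℝ)/4)))) := by
  obtain ⟨M, hM⟩ := hbd
  have ha : a < 0 := (hI (by simp : (0 : ℝ) ∈ _)).1
  have hb : 1 < b := (hI (by simp : (1 : ℝ) ∈ _)).2
  set s : Set ℝ := Set.Icc (a / 2) ((1 + b) / 2)
  have hsub : s ⊆ Set.Ioo a b := fun x hx => ⟨by linarith [hx.1], by linarith [hx.2]⟩
  have h01 : Set.Icc (0 : ℝ) 1 ⊆ s := Set.Icc_subset_Icc (by linarith) (by linarith)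
  have h0s : (0 : ℝ) ∈ s := h01 (by simp)
  have h1s : (1 : ℝ) ∈ s := h01 (by simp)
  have hf : ∀ x ∈ s, 2 < f x := fun x hx => hf2 x (hsub hx)
  have hfc : ∀ x ∈ s, ContinuousAt f x := fun x hx => (hd1 x (hsub hx)).continuousAt
  have taylor : ∀ {Φ : ℝ → ℝ}, (∀ t, 2 < t → ContDiffAt ℝ 2 Φ t) → ∃ K, 0 ≤ K ∧
      HasTaylorBound (fun x => Φ (f x)) (fun x => deriv Φ (f x) * f' x) s K := fun {Φ} hΦ =>
    exists_hasTaylorBound_comp isOpen_Ioi (fun t ht => (hΦ t ht).contDiffWithinAt) hf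
      (fun x hx => hd1 x (hsub hx)) (fun x hx => hd2 x (hsub hx)) (fun x hx => hM x (hsub hx))
  have hpos : ∀ {t : ℝ}, 2 < t → growthRate t ≠ 0 := fun ht => by linarith [one_lt_growthRate ht]
  obtain ⟨K₁, hK₁, hg⟩ := taylor fun t => contDiffAt_wkbAmplitude
  obtain ⟨K₂, hK₂, hw⟩ := taylor (Φ := fun t => (growthRate t)⁻¹ * wkbAmplitude t) fun t ht =>
    ((contDiffAt_growthRate ht).inv (hpos ht)).mul (contDiffAt_wkbAmplitude ht)
  obtain ⟨K₃, -, hlog⟩ := taylor (Φ := fun t => Real.log (growthRate t)) fun t ht =>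
    (contDiffAt_growthRate ht).log (hpos ht)
  have hcs : ContinuousOn f s := fun x hx => (hfc x hx).continuousWithinAt
  obtain ⟨x₀, hx₀, hmin⟩ := isCompact_Icc.exists_isMinOn ⟨0, h0s⟩ hcs
  obtain ⟨x₁, hx₁, hmax⟩ := isCompact_Icc.exists_isMaxOn ⟨0, h0s⟩ hcs
  set p₀ := f x₀ / 2 with hp₀
  have hp₀1 : 1 < p₀ := by linarith [hf x₀ hx₀]
  have hlow : ∀ x ∈ s, p₀ ≤ growthRate (f x) := fun x hx => by
    linarith [half_le_growthRate (f x), isMinOn_iff.1 hmin x hx]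
  have hupp : ∀ x ∈ s, growthRate (f x) ≤ f x₁ := fun x hx =>
    (growthRate_le (hf x hx)).trans (isMaxOn_iff.1 hmax x hx)
  set p := (1 + p₀) / 2 with hp
  have hp1 : 1 < p := by linarith
  set C := f x₁ * K₁ + K₂ with hC
  have hC0 : 0 ≤ C := by
    have := hf x₁ hx₁
    positivity
  set B := C * p / (p - 1) with hB
  have hB0 : 0 ≤ B := div_nonneg (by positivity) (by linarith)
  set X : ℕ → ℕ → ℝ := fun n k => ((k : ℝ) + ε) / n with hX
  set F : ℕ → ℕ → ℝ := fun n k => f (X n k) with hF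
  set R : ℕ → ℕ → ℝ := fun n k =>
    growthRate (F n k) * (wkbAmplitude (F n (k + 1)) / wkbAmplitude (F n k)) with hR
  have hXmem : ∀ᶠ n : ℕ in atTop, ∀ k ≤ n, X n k ∈ s := by
    have hsm : 0 < min (-a / 2) ((b - 1) / 2) := lt_min (by linarith) (by linarith)
    filter_upwards [eventually_gt_atTop 0, (tendsto_const_div_atTop_nhds_zero_nat |ε|).eventually
      (eventually_lt_nhds hsm)] with n hn hε k hk
    have hn' : (0 : ℝ) < n := by exact_mod_cast hn
    have hk' : (k : ℝ) / n ≤ 1 := by rw [div_le_one hn']; exact_mod_cast hk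
    have hk0 : 0 ≤ (k : ℝ) / n := by positivity
    have hεn : |ε / n| = |ε| / n := by rw [abs_div, Nat.abs_cast]
    have h1 := hε.trans_le (min_le_left _ _)
    have h2 := hε.trans_le (min_le_right _ _)
    rw [← hεn] at h1 h2
    simp only [hX, add_div]
    exact ⟨by linarith [neg_le_of_abs_le h1.le], by linarith [le_of_abs_le h2.le]⟩
  have hXstep : ∀ n k, X n (k + 1) = X n k + 1 / n := fun n k => by
    simp only [hX]
    push_cast
    ring
  have hX0 : ∀ k, Tendsto (fun n => X n k) atTop (𝓝 0) := fun k =>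
    tendsto_const_div_atTop_nhds_zero_nat _
  have hX1 : Tendsto (fun n => X n n) atTop (𝓝 1) := by
    have := (tendsto_const_div_atTop_nhds_zero_nat ε).const_add 1
    rw [add_zero] at this
    refine this.congr' ?_
    filter_upwards [eventually_gt_atTop 0] with n hn
    have : (n : ℝ) ≠ 0 := by exact_mod_cast hn.ne'
    simp only [hX]
    field_simp
  have hRlow : ∀ᶠ n in atTop, ∀ k < n, p ≤ R n k := by
    have hlim : Tendsto (fun n : ℕ => p₀ * (1 - K₁ / n)) atTop (𝓝 p₀) := by
      simpa using ((tendsto_const_div_atTop_nhds_zero_nat K₁).const_sub 1).const_mul p₀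
    filter_upwards [hXmem, hlim.eventually (eventually_ge_nhds (by linarith : p < p₀)),
      eventually_gt_atTop 0] with n hmem hn hn0 k hk
    have m0 := hmem k hk.le
    have m1 := hmem (k + 1) hk
    refine hn.trans ?_
    have hstep := hg.1 _ m0 _ m1
    rw [show X n (k + 1) - X n k = 1 / n by rw [hXstep]; ring,
      abs_of_nonneg (by positivity : (0 : ℝ) ≤ 1 / n), mul_one_div] at hstep
    have g0 := one_le_wkbAmplitude (hf _ m0)
    have hKn : 0 ≤ K₁ / n := by positivity
    have hratio : 1 - K₁ / n ≤ wkbAmplitude (F n (k + 1)) / wkbAmplitude (F n k) := by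
      rw [le_div_iff₀ (by linarith)]
      have := neg_le_of_abs_le hstep
      nlinarith
    have hl := hlow _ m0
    have hratio0 : 0 ≤ wkbAmplitude (F n (k + 1)) / wkbAmplitude (F n k) :=
      div_nonneg (by linarith [one_le_wkbAmplitude (hf _ m1)]) (by linarith)
    calc p₀ * (1 - K₁ / n)
        ≤ p₀ * (wkbAmplitude (F n (k + 1)) / wkbAmplitude (F n k)) := by gcongr
      _ ≤ R n k := mul_le_mul_of_nonneg_right hl hratio0
  have hBlim : Tendsto (fun n : ℕ => B / (n : ℝ) ^ 2) atTop (𝓝 0) :=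
    tendsto_const_nhds.div_atTop ((tendsto_pow_atTop two_ne_zero).comp tendsto_natCast_atTop_atTop)
  have hBsmall : ∀ᶠ n : ℕ in atTop, B / (n : ℝ) ^ 2 ≤ (p - 1) / 2 :=
    hBlim.eventually (eventually_le_nhds (by linarith))
  have hclose : ∀ᶠ n : ℕ in atTop, ∀ k < n,
      |riccati (F n) (R n 0) k - R n k| ≤ B / (n : ℝ) ^ 2 := by
    filter_upwards [hXmem, hRlow, hBsmall, eventually_gt_atTop 0] with n hmem hRl hBs hn k hk
    have hn' : (0 : ℝ) < n := by exact_mod_cast hn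
    have hp1' : p - 1 ≠ 0 := by linarith
    refine abs_riccati_sub_le (η := C / (n : ℝ) ^ 2) hp1 hRl (by positivity) hBs ?_ ?_ k hk
    · refine le_of_eq ?_
      rw [hB]
      field_simp
      ring
    · intro j hj
      have e0 : X n (j + 1) - 1 / n = X n j := by rw [hXstep]; ring
      have e2 : X n (j + 1) + 1 / n = X n (j + 1 + 1) := by rw [hXstep n (j + 1)]
      have := abs_wkb_residual_le hf hupp hg hw (x := X n (j + 1)) (h := 1 / n)
        (by rw [e0]; exact hmem j (by omega)) (hmem (j + 1) hj.le) (by rw [e2]; exact hmem _ hj)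
      rw [e0, e2] at this
      refine this.trans_eq ?_
      rw [hC]
      field_simp
  have hlim0 : ∀ {Φ : ℝ → ℝ}, (∀ t, 2 < t → ContinuousAt Φ t) → ∀ k,
      Tendsto (fun n => Φ (F n k)) atTop (𝓝 (Φ (f 0))) := fun hΦ k =>
    (hΦ _ (hf 0 h0s)).tendsto.comp ((hfc 0 h0s).tendsto.comp (hX0 k))
  have hampne : ∀ {t : ℝ}, 2 < t → wkbAmplitude t ≠ 0 := fun ht => by
    linarith [one_le_wkbAmplitude ht]
  have hcg : ∀ t, 2 < t → ContinuousAt growthRate t := fun t ht =>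
    (contDiffAt_growthRate ht).continuousAt
  have hca : ∀ t, 2 < t → ContinuousAt wkbAmplitude t := fun t ht =>
    (contDiffAt_wkbAmplitude ht).continuousAt
  have hRlim : ∀ k, Tendsto (fun n => R n k) atTop (𝓝 (growthRate (f 0))) := fun k => by
    have := (hlim0 hcg k).mul ((hlim0 hca (k + 1)).div (hlim0 hca k) (hampne (hf 0 h0s)))
    rwa [div_self (hampne (hf 0 h0s)), mul_one] at this
  have hrlim : ∀ k, Tendsto (fun n => riccati (F n) (R n 0) k) atTop (𝓝 (growthRate (f 0))) := by
    intro k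
    have hdiff : Tendsto (fun n => riccati (F n) (R n 0) k - R n k) atTop (𝓝 0) := by
      refine squeeze_zero_norm' ?_ hBlim
      filter_upwards [hclose, eventually_gt_atTop k] with n hn hk using hn k hk
    simpa using hdiff.add (hRlim k)
  have hT1 : Tendsto (fun n => continuant (F n) n /
      ∏ j ∈ Finset.range n, riccati (F n) (R n 0) j) atTop
      (𝓝 (1 / (1 - (1 / growthRate (f 0)) ^ 2))) := by
    refine tendsto_continuant_div_prod (p := (p + 1) / 2) (by linarith)
      (one_lt_growthRate (hf 0 h0s)) ?_ hrlim ?_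
    · filter_upwards [hclose, hRlow, hBsmall] with n hn hRl hBs k hk
      linarith [neg_le_of_abs_le (hn k hk), hRl k hk]
    · rw [one_div, growthRate_add_inv (hf 0 h0s)]
      exact hlim0 (Φ := id) (fun _ _ => continuousAt_id) 0
  have hT2 : Tendsto (fun n => (∏ j ∈ Finset.range n, riccati (F n) (R n 0) j) /
      ∏ j ∈ Finset.range n, R n j) atTop (𝓝 1) :=
    tendsto_prod_div_prod (hRlow.mono fun n hn k hk => hp1.le.trans (hn k hk)) hclose
  have hT3 : Tendsto (fun n => Real.exp (∑ k ∈ Finset.range n, Real.log (growthRate (F n k))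
      - n * ∫ x in (0 : ℝ)..1, Real.log (growthRate (f x))) *
        (wkbAmplitude (F n n) / wkbAmplitude (F n 0))) atTop
      (𝓝 (Real.exp ((ε - 1 / 2) * (Real.log (growthRate (f 1)) - Real.log (growthRate (f 0)))) *
        (wkbAmplitude (f 1) / wkbAmplitude (f 0)))) :=
    ((Real.continuous_exp.tendsto _).comp (tendsto_sum_sub_integral ε hlog h01 hXmem)).mul
      (((hca _ (hf 1 h1s)).tendsto.comp ((hfc 1 h1s).tendsto.comp hX1)).div (hlim0 hca 0)
        (hampne (hf 0 h0s)))
  have hmain := (hT1.mul hT2).mul hT3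
  rw [mul_one, kac_limit_eq (hf 0 h0s) (hf 1 h1s)] at hmain
  refine hmain.congr' ?_
  filter_upwards [hXmem, hclose, hRlow, hBsmall] with n hmem hcl hRl hBs
  have hdet : (TmatShift f ε n).det = continuant (F n) n := det_tridiagonal (F n) n
  have hG : Gf f ^ n = Real.exp (n * ∫ x in (0 : ℝ)..1, Real.log (growthRate (f x))) :=
    (Real.exp_nat_mul _ _).symm
  have hprodR : ∏ k ∈ Finset.range n, R n k
      = Real.exp (∑ k ∈ Finset.range n, Real.log (growthRate (F n k))) *
        (wkbAmplitude (F n n) / wkbAmplitude (F n 0)) := by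
    rw [Real.exp_sum, prod_range_mul_div (fun k => growthRate (F n k))
      (fun k => wkbAmplitude (F n k)) n fun k hk => hampne (hf _ (hmem k hk))]
    congr 1
    refine Finset.prod_congr rfl fun k hk => (Real.exp_log ?_).symm
    linarith [one_lt_growthRate (hf _ (hmem k (Finset.mem_range.1 hk).le))]
  have hr0 : ∏ j ∈ Finset.range n, riccati (F n) (R n 0) j ≠ 0 :=
    Finset.prod_ne_zero_iff.2 fun k hk => by
      have hk := Finset.mem_range.1 hk
      linarith [neg_le_of_abs_le (hcl k hk), hRl k hk]
  have hR0 : ∏ j ∈ Finset.range n, R n j ≠ 0 :=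
    Finset.prod_ne_zero_iff.2 fun k hk => by linarith [hRl k (Finset.mem_range.1 hk)]
  rw [hdet, hG, div_mul_div_cancel₀ hr0, Real.exp_sub,
    div_mul_eq_mul_div (Real.exp _) (Real.exp _), ← hprodR, div_mul_div_cancel₀ hR0]
end

section
/- Let c = p/q ∈ (0,1) be rational with p, q coprime positive integers, and let f : [0,1] → ℝ have a single jump discontinuity at c, be right-continuous at c, and satisfy: there are functions g_0 (twice differentiable with bounded second derivative on [0,c]) and g_1 (twice differentiable with bounded second derivative on [c,1]) with f(x) = g_0(x) for x ∈ [0,c), f(x) = g_1(x) for x ∈ [c,1], g_0(c) ≠ g_1(c), and f > 2 + δ for some δ > 0. Set f(c−) = g_0(c), f(c+) = g_1(c), α = (1/2)(f(1)+√(f(1)²−4))/((f(0)²−4)(f(1)²−4))^{1/4}, β = (f(c−) − f(c+) + √(f(c+)² − 4) + √(f(c−)² − 4)) / (2((f(c+)² − 4)(f(c−)² − 4))^{1/4}), and γ = (f(c+) + √(f(c+)² − 4)) / (f(c−) + √(f(c−)² − 4)). Then limsup_{n→∞} D_n(f)/G(f)^n = α·β·max{γ^{1/q}, γ} and liminf_{n→∞}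 D_n(f)/G(f)^n = α·β·min{γ^{1/q}, γ}. -/
open Filter Topology

/-- The n×n discrete Schrödinger matrix with diagonal f(1/n), …, f(n/n) and −1 on the
first super- and subdiagonals. -/
noncomputable def Tmat (f : ℝ → ℝ) (n : ℕ) : Matrix (Fin n) (Fin n) ℝ :=
  Matrix.of fun i j =>
    if (i : ℕ) = (j : ℕ) then f (((i : ℕ) + 1 : ℝ) / (n : ℝ))
    else if (i : ℕ) + 1 = (j : ℕ) ∨ (j : ℕ) + 1 = (i : ℕ) then -1 else 0

/-- D_n(f) = det T_n(f). -/
noncomputable def Dn (f : ℝ → ℝ) (n : ℕ) : ℝ := (Tmat f n).det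

/-- The tridiagonal matrix with diagonal `b 1, …, b n` and `-1` next to the diagonal. -/
def tridiag (b : ℕ → ℝ) (n : ℕ) : Matrix (Fin n) (Fin n) ℝ :=
  Matrix.of fun i j =>
    if (i : ℕ) = (j : ℕ) then b ((i : ℕ) + 1)
    else if (i : ℕ) + 1 = (j : ℕ) ∨ (j : ℕ) + 1 = (i : ℕ) then -1 else 0

theorem det_tridiag_add_two (b : ℕ → ℝ) (n : ℕ) :
    (tridiag b (n + 2)).det = b (n + 2) * (tridiag b (n + 1)).det - (tridiag b n).det := by
  rw [Matrix.det_succ_row _ (Fin.last (n + 1)), Fin.sum_univ_castSucc, Fin.sum_univ_castSucc]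
  have h1 : (tridiag b (n + 2)).submatrix (Fin.last (n + 1)).succAbove
      (Fin.last (n + 1)).succAbove = tridiag b (n + 1) := by
    ext i j; simp [tridiag]
  have h2 : ((tridiag b (n + 2)).submatrix (Fin.last (n + 1)).succAbove
      (Fin.last n).castSucc.succAbove).det = - (tridiag b n).det := by
    rw [Matrix.det_succ_column _ (Fin.last n), Fin.sum_univ_castSucc]
    have h3 : (((tridiag b (n + 2)).submatrix (Fin.last (n + 1)).succAbove
      (Fin.last n).castSucc.succAbove).submatrix (Fin.last n).succAbove
        (Fin.last n).succAbove) = tridiag b n := by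
      ext i j
      have e : (Fin.last n).castSucc.succAbove j.castSucc = j.castSucc.castSucc := by
        apply Fin.succAbove_of_castSucc_lt
        simp [Fin.lt_def]
      simp [tridiag, e]
    rw [h3]
    have e : (Fin.last n).castSucc.succAbove (Fin.last n) = Fin.last (n + 1) := by
      rw [Fin.succAbove_of_le_castSucc _ _ le_rfl]; simp
    rw [Finset.sum_eq_zero]
    · simp [tridiag, e]
    · intro i _
      have : (i : ℕ) < n := i.2
      simp only [Matrix.submatrix_apply, e, tridiag, Matrix.of_apply, Fin.succAbove_last,
        Fin.val_castSucc, Fin.val_last]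
      rw [if_neg (by omega), if_neg (by omega)]; simp
  rw [h1, h2, Finset.sum_eq_zero]
  · simp only [tridiag, Matrix.of_apply, Fin.val_castSucc, Fin.val_last]
    simp [pow_add, ← mul_pow]
    ring
  · intro i _
    have : (i : ℕ) < n := i.2
    simp only [tridiag, Matrix.of_apply, Fin.val_castSucc, Fin.val_last]
    rw [if_neg (by omega), if_neg (by omega)]; simp

/-- Ratios `D_{k-1} / D_k` of consecutive leading principal minors of `tridiag b`. -/
noncomputable def minorRatio (b : ℕ → ℝ) : ℕ → ℝ
  | 0 => 0
  | k + 1 => (b (k + 1) - minorRatio b k)⁻¹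

theorem det_tridiag_eq_prod (b : ℕ → ℝ) (n : ℕ)
    (h : ∀ k ≤ n, minorRatio b k = 0 → k = 0) :
    (tridiag b n).det = ∏ k ∈ Finset.range n, (minorRatio b (k + 1))⁻¹ := by
  induction n using Nat.strong_induction_on with
  | _ n ih =>
    match n with
    | 0 => simp [tridiag]
    | 1 => simp [tridiag, minorRatio]
    | n + 2 =>
      rw [det_tridiag_add_two, Finset.prod_range_succ, ih (n + 1) (by omega) fun k hk =>
        h k (by omega), ih n (by omega) fun k hk => h k (by omega), Finset.prod_range_succ]
      have h0 : minorRatio b (n + 1) ≠ 0 := fun h' => by have := h (n + 1) (by omega) h'; omega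
      have h1 : (minorRatio b (n + 2))⁻¹ = b (n + 2) - minorRatio b (n + 1) := by
        simp [minorRatio]
      rw [show n + 1 + 1 = n + 2 from rfl, h1]
      field_simp

theorem minorRatio_step {ρ u w : ℝ} (hρ : ρ < 1) (hu : 0 < u) (huρ : u ≤ ρ) (hw : 0 ≤ w)
    (hwρ : w ≤ ρ) :
    0 < (u + u⁻¹ - w)⁻¹ ∧ (u + u⁻¹ - w)⁻¹ ≤ ρ ∧
      u - (u + u⁻¹ - w)⁻¹ = u * (u + u⁻¹ - w)⁻¹ * (u - w) ∧
      Real.log u - Real.log (u + u⁻¹ - w)⁻¹ =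
        Real.log (1 - u * w) - Real.log (1 - u * (u + u⁻¹ - w)⁻¹) := by
  have hρ0 : 0 < ρ := hu.trans_le huρ
  have key : ρ⁻¹ ≤ u + u⁻¹ - w := by
    have : u + u⁻¹ - ρ - ρ⁻¹ = (ρ - u) * (1 - u * ρ) / (u * ρ) := by field_simp; ring
    have h2 : 0 ≤ (ρ - u) * (1 - u * ρ) / (u * ρ) := by
      apply div_nonneg _ (by positivity)
      apply mul_nonneg <;> nlinarith
    linarith
  have hpos : 0 < u + u⁻¹ - w := lt_of_lt_of_le (by positivity) key
  have h1 : (u + u⁻¹ - w)⁻¹ ≤ ρ := inv_le_of_inv_le₀ hρ0 key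
  have h3 : u - (u + u⁻¹ - w)⁻¹ = u * (u + u⁻¹ - w)⁻¹ * (u - w) := by
    generalize hx : u + u⁻¹ - w = x at *
    have : w = u + u⁻¹ - x := by linarith
    subst this; field_simp; ring
  refine ⟨by positivity, h1, h3, ?_⟩
  have h4 : 0 < 1 - u * w := by nlinarith
  have h5 : 0 < 1 - u * (u + u⁻¹ - w)⁻¹ := by nlinarith [inv_pos.2 hpos]
  rw [← Real.log_div hu.ne' (by positivity), ← Real.log_div h4.ne' h5.ne']
  congr 1
  generalize hx : u + u⁻¹ - w = x at *
  have : w = u + u⁻¹ - x := by linarith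
  rw [div_eq_div_iff (by positivity) h5.ne']
  subst this; field_simp; ring

theorem abs_log_sub_log_le {x y m : ℝ} (hm : 0 < m) (hx : m ≤ x) (hy : m ≤ y) :
    |Real.log x - Real.log y| ≤ |x - y| / m := by
  have key : ∀ {x y : ℝ}, m ≤ x → m ≤ y → Real.log x - Real.log y ≤ |x - y| / m := by
    intro x y hx hy
    have hx0 := hm.trans_le hx
    have hy0 := hm.trans_le hy
    rw [← Real.log_div hx0.ne' hy0.ne']
    calc Real.log (x / y) ≤ x / y - 1 := Real.log_le_sub_one_of_pos (by positivity)
      _ = (x - y) / y := by field_simp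
      _ ≤ |x - y| / y := by gcongr; exact le_abs_self _
      _ ≤ |x - y| / m := by gcongr
  rw [abs_le]
  constructor
  · have := key hy hx
    rw [abs_sub_comm] at this; linarith
  · exact key hx hy

/-- Replacing `w` by either `u` or `u'` turns the increment of `log (1 - u w)` in `u` into half the
increment of `log (1 - u ^ 2)`, up to a second order error. -/
theorem abs_log_increment_le {ρ u u' w : ℝ} (hρ : ρ < 1) (hu : 0 ≤ u) (huρ : u ≤ ρ)
    (hu' : 0 ≤ u') (huρ' : u' ≤ ρ) (hw : 0 ≤ w) (hwρ : w ≤ ρ) :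
    |Real.log (1 - u' * w) - Real.log (1 - u * w)
      - (Real.log (1 - u' ^ 2) - Real.log (1 - u ^ 2)) / 2| ≤
      |u' - u| * (2 * |u - w| + |u' - u|) / (1 - ρ) ^ 3 := by
  have hρ0 : 0 ≤ ρ := hu.trans huρ
  have hm : 0 < 1 - ρ := by linarith
  have bd : ∀ a b : ℝ, 0 ≤ a → a ≤ ρ → 0 ≤ b → b ≤ ρ → 1 - ρ ≤ 1 - a * b := by
    intro a b ha haρ hb hbρ; nlinarith
  have b1 := bd u' w hu' huρ' hw hwρ
  have b2 := bd u w hu huρ hw hwρ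
  have b3 := bd u u hu huρ hu huρ
  have b4 := bd u' u' hu' huρ' hu' huρ'
  rw [← pow_two] at b3 b4
  have p1 := hm.trans_le b1
  have p2 := hm.trans_le b2
  have p3 := hm.trans_le b3
  have p4 := hm.trans_le b4
  have e : Real.log (1 - u' * w) - Real.log (1 - u * w)
      - (Real.log (1 - u' ^ 2) - Real.log (1 - u ^ 2)) / 2 =
      (Real.log ((1 - u' * w) ^ 2 * (1 - u ^ 2)) -
        Real.log ((1 - u * w) ^ 2 * (1 - u' ^ 2))) / 2 := by
    rw [Real.log_mul (by positivity) (by positivity), Real.log_mul (by positivity) (by positivity),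
      Real.log_pow, Real.log_pow]
    push_cast; ring
  have l1 : (1 - ρ) ^ 3 ≤ (1 - u' * w) ^ 2 * (1 - u ^ 2) := by
    calc (1 - ρ) ^ 3 = (1 - ρ) ^ 2 * (1 - ρ) := by ring
      _ ≤ _ := by gcongr
  have l2 : (1 - ρ) ^ 3 ≤ (1 - u * w) ^ 2 * (1 - u' ^ 2) := by
    calc (1 - ρ) ^ 3 = (1 - ρ) ^ 2 * (1 - ρ) := by ring
      _ ≤ _ := by gcongr
  have h := abs_log_sub_log_le (by positivity) l1 l2
  have e2 : (1 - u' * w) ^ 2 * (1 - u ^ 2) - (1 - u * w) ^ 2 * (1 - u' ^ 2) =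
      (u' - u) * ((u - w) * (1 - u' * w) + (u' - w) * (1 - u * w)) := by ring
  rw [e, abs_div, abs_two]
  rw [e2, abs_mul] at h
  have h2 : |(u - w) * (1 - u' * w) + (u' - w) * (1 - u * w)| ≤ 2 * |u - w| + |u' - u| := by
    calc _ ≤ |u - w| * |1 - u' * w| + |u' - w| * |1 - u * w| := by
          rw [← abs_mul, ← abs_mul]; exact abs_add_le _ _
      _ ≤ |u - w| * 1 + |u' - w| * 1 := by
          rw [abs_of_pos p1, abs_of_pos p2]
          gcongr
          · linarith [mul_nonneg hu' hw]
          · linarith [mul_nonneg hu hw]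
      _ ≤ _ := by
          have := abs_sub_le u' u w
          linarith
  have h3 : |u' - u| * |(u - w) * (1 - u' * w) + (u' - w) * (1 - u * w)| / (1 - ρ) ^ 3 ≤
      |u' - u| * (2 * |u - w| + |u' - u|) / (1 - ρ) ^ 3 := by gcongr
  have := abs_nonneg (Real.log ((1 - u' * w) ^ 2 * (1 - u ^ 2)) -
        Real.log ((1 - u * w) ^ 2 * (1 - u' ^ 2)))
  linarith

theorem ratio_deviation_step {ρ u u' w h : ℝ} (hρ : ρ < 1) (hu' : 0 < u')
    (huρ' : u' ≤ ρ) (hw : 0 ≤ w) (hwρ : w ≤ ρ) (h_inc : |u' - u| ≤ h) :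
    |u' - (u' + u'⁻¹ - w)⁻¹| ≤ ρ * (|u - w| + h) := by
  obtain ⟨s1, s2, s3, -⟩ := minorRatio_step hρ hu' huρ' hw hwρ
  rw [s3, abs_mul, abs_mul, abs_of_pos hu', abs_of_pos s1]
  have h1 : |u' - w| ≤ |u - w| + h := by
    have := abs_sub_le u' u w
    linarith
  have h2 : u' * (u' + u'⁻¹ - w)⁻¹ ≤ ρ := by nlinarith
  have : 0 ≤ ρ := by linarith
  gcongr

theorem abs_sub_minorRatio_le {ρ h : ℝ} (hρ : ρ < 1) (hh : 0 ≤ h) {u w : ℕ → ℝ} {N : ℕ}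
    (hu : ∀ k ≤ N, 0 < u k ∧ u k ≤ ρ) (hw : ∀ k ≤ N, 0 ≤ w k ∧ w k ≤ ρ)
    (hrec : ∀ k < N, w (k + 1) = (u (k + 1) + (u (k + 1))⁻¹ - w k)⁻¹)
    (h_inc : ∀ k < N, |u (k + 1) - u k| ≤ h) :
    |u N - w N| ≤ ρ ^ N + h / (1 - ρ) := by
  have hρ0 : 0 ≤ ρ := (hu 0 (Nat.zero_le _)).1.le.trans (hu 0 (Nat.zero_le _)).2
  have hm : 0 < 1 - ρ := by linarith
  have key : ∀ k ≤ N, |u k - w k| ≤ ρ ^ k + h / (1 - ρ) := by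
    intro k
    induction k with
    | zero =>
      intro hk
      have := hu 0 hk
      have := hw 0 hk
      have : 0 ≤ h / (1 - ρ) := by positivity
      rw [pow_zero, abs_le]; constructor <;> linarith
    | succ k ih =>
      intro hk
      have h1 := ratio_deviation_step hρ (hu _ hk).1 (hu _ hk).2 (hw k (by omega)).1
        (hw k (by omega)).2 (h_inc k (by omega))
      rw [hrec k (by omega)]
      calc _ ≤ _ := h1
        _ ≤ ρ * (ρ ^ k + h / (1 - ρ) + h) := by gcongr; exact ih (by omega)
        _ = ρ ^ (k + 1) + h / (1 - ρ) - h * (1 - ρ) := by field_simp; ring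
        _ ≤ _ := by nlinarith
  exact key N le_rfl

theorem abs_sum_log_sub_le {ρ h : ℝ} (hρ : ρ < 1) (hh : 0 ≤ h) {u w : ℕ → ℝ} {N : ℕ}
    (hu : ∀ k ≤ N, 0 < u k ∧ u k ≤ ρ) (hw : ∀ k ≤ N, 0 ≤ w k ∧ w k ≤ ρ)
    (hrec : ∀ k < N, w (k + 1) = (u (k + 1) + (u (k + 1))⁻¹ - w k)⁻¹)
    (h_inc : ∀ k < N, |u (k + 1) - u k| ≤ h) :
    |∑ k ∈ Finset.range N, (Real.log (u (k + 1)) - Real.log (w (k + 1))) -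
      (Real.log (1 - u 0 * w 0) - Real.log (1 - u N * w N) +
        (Real.log (1 - u N ^ 2) - Real.log (1 - u 0 ^ 2)) / 2)| ≤
      3 / (1 - ρ) ^ 4 * h * (1 + N * h) := by
  have hρ0 : 0 ≤ ρ := (hu 0 (Nat.zero_le _)).1.le.trans (hu 0 (Nat.zero_le _)).2
  have hm : 0 < 1 - ρ := by linarith
  have key : ∀ k ≤ N, |∑ k ∈ Finset.range k, (Real.log (u (k + 1)) - Real.log (w (k + 1))) -
      (Real.log (1 - u 0 * w 0) - Real.log (1 - u k * w k) +
        (Real.log (1 - u k ^ 2) - Real.log (1 - u 0 ^ 2)) / 2)| +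
        2 / (1 - ρ) ^ 4 * h * |u k - w k| ≤
      2 / (1 - ρ) ^ 4 * h * |u 0 - w 0| + 3 / (1 - ρ) ^ 4 * h ^ 2 * k := by
    intro k
    induction k with
    | zero => intro _; simp
    | succ k ih =>
      intro hk
      have ih := ih (by omega)
      obtain ⟨u1, u2⟩ := hu k (by omega)
      obtain ⟨v1, v2⟩ := hu (k + 1) hk
      obtain ⟨w1, w2⟩ := hw k (by omega)
      have hi := h_inc k (by omega)
      have h1 := ratio_deviation_step hρ v1 v2 w1 w2 hi
      obtain ⟨-, -, -, s4⟩ := minorRatio_step hρ v1 v2 w1 w2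
      have h2 := abs_log_increment_le hρ u1.le u2 v1.le v2 w1 w2
      rw [← hrec k (by omega)] at h1 s4
      have h3 : |u (k + 1) - u k| * (2 * |u k - w k| + |u (k + 1) - u k|) / (1 - ρ) ^ 3 ≤
          h * (2 * |u k - w k| + h) / (1 - ρ) ^ 3 := by gcongr
      have h4 : h * (2 * |u k - w k| + h) / (1 - ρ) ^ 3 =
          2 / (1 - ρ) ^ 4 * h * ((1 - ρ) * |u k - w k|) + h ^ 2 / (1 - ρ) ^ 4 * (1 - ρ) := by
        field_simp
      have h5 : h ^ 2 / (1 - ρ) ^ 4 * (1 - ρ) ≤ h ^ 2 / (1 - ρ) ^ 4 * 1 := by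
        gcongr; linarith
      have h6 : 2 / (1 - ρ) ^ 4 * h * |u (k + 1) - w (k + 1)| ≤
          2 / (1 - ρ) ^ 4 * h * (ρ * |u k - w k| + h) := by
        gcongr
        nlinarith
      have h7 := abs_add_le
        (∑ k ∈ Finset.range k, (Real.log (u (k + 1)) - Real.log (w (k + 1))) -
          (Real.log (1 - u 0 * w 0) - Real.log (1 - u k * w k) +
            (Real.log (1 - u k ^ 2) - Real.log (1 - u 0 ^ 2)) / 2))
        (Real.log (1 - u (k + 1) * w k) - Real.log (1 - u k * w k)
          - (Real.log (1 - u (k + 1) ^ 2) - Real.log (1 - u k ^ 2)) / 2)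
      rw [Finset.sum_range_succ, s4]
      push_cast
      rw [show ∀ S a b c d e' f g : ℝ, S + (a - b) - (c - b + (d - e') / 2) =
        (S - (c - f + (g - e') / 2)) + (a - f - (d - g) / 2) by intros; ring]
      simp only [div_eq_mul_inv _ ((1 - ρ) ^ 4)] at *
      linarith
  have h0 := key N le_rfl
  have h1 : |u 0 - w 0| ≤ 1 := by
    have := hu 0 (Nat.zero_le _)
    have := hw 0 (Nat.zero_le _)
    rw [abs_le]; constructor <;> linarith
  have h2 : 2 / (1 - ρ) ^ 4 * h * |u 0 - w 0| ≤ 3 / (1 - ρ) ^ 4 * h * 1 := by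
    gcongr; norm_num
  have h3 : 0 ≤ 2 / (1 - ρ) ^ 4 * h * |u N - w N| := by positivity
  linarith

theorem abs_integral_sub_trapezoid_le {φ φ' : ℝ → ℝ} {x y M : ℝ} (hxy : x ≤ y) (hM : 0 ≤ M)
    (hc : ContinuousOn φ (Set.Icc x y))
    (hT : ∀ t ∈ Set.Icc x y, |φ t - φ x - (t - x) * φ' x| ≤ M * (t - x) ^ 2) :
    |(y - x) * (φ x + φ y) / 2 - ∫ t in x..y, φ t| ≤ 2 * M * (y - x) ^ 3 := by
  have hi : IntervalIntegrable φ MeasureTheory.volume x y :=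
    (hc.mono (by rw [Set.uIcc_of_le hxy])).intervalIntegrable
  have h1 : ‖∫ t in x..y, (φ t - φ x - (t - x) * φ' x)‖ ≤ M * (y - x) ^ 2 * |y - x| := by
    apply intervalIntegral.norm_integral_le_of_norm_le_const
    intro t ht
    rw [Set.uIoc_of_le hxy] at ht
    refine (hT t ⟨ht.1.le, ht.2⟩).trans ?_
    have := ht.1; have := ht.2
    gcongr
  have h2 : ∫ t in x..y, (φ t - φ x - (t - x) * φ' x) =
      (∫ t in x..y, φ t) - (y - x) * φ x - (y - x) ^ 2 / 2 * φ' x := by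
    rw [intervalIntegral.integral_sub (hi.sub intervalIntegrable_const)
      (Continuous.intervalIntegrable (by fun_prop) _ _),
      intervalIntegral.integral_sub hi intervalIntegrable_const,
      intervalIntegral.integral_mul_const,
      intervalIntegral.integral_sub (Continuous.intervalIntegrable (by fun_prop) _ _)
        intervalIntegrable_const, integral_id]
    simp only [intervalIntegral.integral_const, smul_eq_mul]
    ring
  rw [h2, Real.norm_eq_abs, abs_of_nonneg (by linarith : 0 ≤ y - x)] at h1
  have h3 := hT y ⟨hxy, le_rfl⟩
  have h4 : |(y - x) / 2 * (φ y - φ x - (y - x) * φ' x)| ≤ (y - x) / 2 * (M * (y - x) ^ 2) := by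
    rw [abs_mul, abs_of_nonneg (by linarith : 0 ≤ (y - x) / 2)]
    gcongr
  rw [abs_le] at *
  have : 0 ≤ M * (y - x) ^ 3 := by have : 0 ≤ y - x := by linarith
                                   positivity
  constructor <;> nlinarith

theorem abs_sum_sub_integral_le {φ φ' : ℝ → ℝ} {a b M h x : ℝ} {N : ℕ} (hh : 0 ≤ h) (hM : 0 ≤ M)
    (hc : ContinuousOn φ (Set.Icc a b))
    (hT : ∀ x ∈ Set.Icc a b, ∀ y ∈ Set.Icc a b, |φ y - φ x - (y - x) * φ' x| ≤ M * (y - x) ^ 2)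
    (hx : a ≤ x) (hN : x + N * h ≤ b) :
    |h * ∑ k ∈ Finset.range N, φ (x + (k + 1 : ℕ) * h) - (∫ t in x..(x + N * h), φ t) -
      h * (φ (x + N * h) - φ x) / 2| ≤ N * (2 * M * h ^ 3) := by
  induction N with
  | zero => simp
  | succ N ih =>
    push_cast at hN ⊢
    have hNh : 0 ≤ (N : ℝ) * h := by positivity
    have ih := ih (by linarith)
    have h1 := abs_integral_sub_trapezoid_le (φ := φ) (φ' := φ') (x := x + N * h)
      (y := x + (N + 1) * h) (by linarith) hM
      (hc.mono (Set.Icc_subset_Icc (by linarith) hN)) (fun t ht => hT _ ⟨by linarith, by linarith⟩ t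
        ⟨by linarith [ht.1], by linarith [ht.2]⟩)
    have h2 : (∫ t in x..(x + N * h), φ t) + (∫ t in (x + N * h)..(x + (N + 1) * h), φ t) =
        ∫ t in x..(x + (N + 1) * h), φ t := by
      apply intervalIntegral.integral_add_adjacent_intervals
      · apply (hc.mono _).intervalIntegrable
        rw [Set.uIcc_of_le (by linarith)]
        exact Set.Icc_subset_Icc hx (by linarith)
      · apply (hc.mono _).intervalIntegrable
        rw [Set.uIcc_of_le (by linarith)]
        exact Set.Icc_subset_Icc (by linarith) (by linarith)
    rw [Finset.sum_range_succ, ← h2, mul_add]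
    push_cast at ih ⊢
    rw [show x + (N + 1) * h - (x + N * h) = h by ring] at h1
    rw [abs_le] at *
    constructor <;> linarith

theorem abs_integral_sub_const_le {φ : ℝ → ℝ} {x y z L : ℝ} (hxy : x ≤ y)
    (hc : ContinuousOn φ (Set.Icc x y)) (hz : z ∈ Set.Icc x y) (hL : 0 ≤ L)
    (hT : ∀ s ∈ Set.Icc x y, ∀ t ∈ Set.Icc x y, |φ t - φ s| ≤ L * |t - s|) :
    |(∫ t in x..y, φ t) - (y - x) * φ z| ≤ L * (y - x) ^ 2 := by
  have hi : IntervalIntegrable φ MeasureTheory.volume x y :=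
    (hc.mono (by rw [Set.uIcc_of_le hxy])).intervalIntegrable
  have h1 : ‖∫ t in x..y, (φ t - φ z)‖ ≤ L * (y - x) * |y - x| := by
    apply intervalIntegral.norm_integral_le_of_norm_le_const
    intro t ht
    rw [Set.uIoc_of_le hxy] at ht
    refine (hT z hz t ⟨ht.1.le, ht.2⟩).trans ?_
    have := ht.1; have := ht.2; have := hz.1; have := hz.2
    gcongr
    rw [abs_le]; constructor <;> linarith
  rw [intervalIntegral.integral_sub hi intervalIntegrable_const,
    intervalIntegral.integral_const, smul_eq_mul, Real.norm_eq_abs,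
    abs_of_nonneg (by linarith : 0 ≤ y - x)] at h1
  linarith

/-- `φ` is continuously differentiable on `[a, b]` with derivative `φ'`, with quantitative control
by `L`, and is bounded below there by `κ`. -/
structure IsSmoothBranch (φ φ' : ℝ → ℝ) (a b L κ : ℝ) : Prop where
  continuousOn : ContinuousOn φ (Set.Icc a b)
  taylor : ∀ x ∈ Set.Icc a b, ∀ y ∈ Set.Icc a b, |φ y - φ x - (y - x) * φ' x| ≤ L * (y - x) ^ 2
  lipschitz : ∀ x ∈ Set.Icc a b, ∀ y ∈ Set.Icc a b, |φ y - φ x| ≤ L * |y - x|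
  lower : ∀ x ∈ Set.Icc a b, κ ≤ φ x

theorem IsSmoothBranch.abs_sum_left_le {φ φ' : ℝ → ℝ} {c L κ h : ℝ} {m : ℕ}
    (H : IsSmoothBranch φ φ' 0 c L κ) (hL : 0 ≤ L) (hc1 : c ≤ 1) (hh : 0 < h) (hm : m * h ≤ c)
    (hm' : c ≤ (m + 1) * h) :
    |∑ k ∈ Finset.range m, φ ((k + 1 : ℕ) * h) - h⁻¹ * (∫ t in (0 : ℝ)..c, φ t) +
      (h⁻¹ * c - m) * φ c - (φ c - φ 0) / 2| ≤ 4 * L * h := by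
  have hmh : 0 ≤ (m : ℝ) * h := by positivity
  have h1 := abs_sum_sub_integral_le (N := m) hh.le hL H.continuousOn H.taylor le_rfl (by linarith)
  have h2 := abs_integral_sub_const_le (x := m * h) (y := c) (z := c) hm
    (H.continuousOn.mono (Set.Icc_subset_Icc hmh le_rfl)) ⟨hm, le_rfl⟩ hL
    fun s hs t ht => H.lipschitz s ⟨hmh.trans hs.1, hs.2⟩ t ⟨hmh.trans ht.1, ht.2⟩
  have h3 := H.lipschitz (m * h) ⟨hmh, hm⟩ c ⟨hmh.trans hm, le_rfl⟩
  have hd : c - m * h ≤ h := by linarith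
  rw [abs_of_nonneg (by linarith : 0 ≤ c - m * h)] at h3
  have e1 : L * (c - m * h) ≤ L * h := by gcongr
  have e2 : L * (c - m * h) ^ 2 ≤ L * h ^ 2 := by gcongr
  have e3 : m * (2 * L * h ^ 3) ≤ 2 * L * h ^ 2 := by
    have : 2 * L * h ^ 2 * (m * h) ≤ 2 * L * h ^ 2 * 1 := by gcongr; linarith
    linarith
  have e4 : (∫ t in (0 : ℝ)..(m * h), φ t) + (∫ t in (m * h)..c, φ t) = ∫ t in (0 : ℝ)..c, φ t := by
    apply intervalIntegral.integral_add_adjacent_intervals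
    · apply (H.continuousOn.mono _).intervalIntegrable
      rw [Set.uIcc_of_le (by linarith)]
      exact Set.Icc_subset_Icc le_rfl hm
    · apply (H.continuousOn.mono _).intervalIntegrable
      rw [Set.uIcc_of_le (by linarith)]
      exact Set.Icc_subset_Icc hmh le_rfl
  simp only [zero_add] at h1
  have e5 : |h * (φ c - φ (m * h)) / 2| ≤ h * (L * h) / 2 := by
    rw [abs_div, abs_mul, abs_of_pos hh, abs_two]
    gcongr
    linarith
  set S := ∑ k ∈ Finset.range m, φ ((k + 1 : ℕ) * h)
  have key : |h * (S - h⁻¹ * (∫ t in (0 : ℝ)..c, φ t) +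
      (h⁻¹ * c - m) * φ c - (φ c - φ 0) / 2)| ≤ h * (4 * L * h) := by
    have : h * (S - h⁻¹ * (∫ t in (0 : ℝ)..c, φ t) + (h⁻¹ * c - m) * φ c - (φ c - φ 0) / 2) =
      h * S - (∫ t in (0 : ℝ)..c, φ t) + (c - m * h) * φ c - h * (φ c - φ 0) / 2 := by
      field_simp
    rw [this, ← e4]
    have : 0 ≤ L * h ^ 2 := by positivity
    rw [abs_le] at *
    constructor <;> linarith
  rw [abs_mul, abs_of_pos hh] at key
  exact le_of_mul_le_mul_left key hh

theorem IsSmoothBranch.abs_sum_right_le {φ φ' : ℝ → ℝ} {c L κ h : ℝ} {m N : ℕ}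
    (H : IsSmoothBranch φ φ' c 1 L κ) (hL : 0 ≤ L) (hc0 : 0 ≤ c) (hh : 0 < h) (hm : m * h ≤ c)
    (hm' : c ≤ (m + 1) * h) (hN : (m + 1 + N) * h = 1) :
    |φ ((m + 1) * h) + ∑ k ∈ Finset.range N, φ ((m + 1) * h + (k + 1 : ℕ) * h)
      - h⁻¹ * (∫ t in c..1, φ t) + (m + 1 - h⁻¹ * c) * φ c - (φ 1 + φ c) / 2| ≤ 4 * L * h := by
  have hNh : 0 ≤ (N : ℝ) * h := by positivity
  have hx1 : (m + 1) * h ≤ 1 := by linarith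
  have h1 := abs_sum_sub_integral_le (N := N) hh.le hL H.continuousOn H.taylor hm' (by linarith)
  have h2 := abs_integral_sub_const_le (x := c) (y := (m + 1) * h) (z := c) hm'
    (H.continuousOn.mono (Set.Icc_subset_Icc le_rfl hx1)) ⟨le_rfl, hm'⟩ hL
    fun s hs t ht => H.lipschitz s ⟨hs.1, hs.2.trans hx1⟩ t ⟨ht.1, ht.2.trans hx1⟩
  have h3 := H.lipschitz c ⟨le_rfl, hm'.trans hx1⟩ ((m + 1) * h) ⟨hm', hx1⟩
  have hd : (m + 1) * h - c ≤ h := by linarith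
  rw [abs_of_nonneg (by linarith : 0 ≤ (m + 1) * h - c)] at h3
  have e1 : L * ((m + 1) * h - c) ≤ L * h := by gcongr
  have e2 : L * ((m + 1) * h - c) ^ 2 ≤ L * h ^ 2 := by gcongr
  have e3 : N * (2 * L * h ^ 3) ≤ 2 * L * h ^ 2 := by
    have : 2 * L * h ^ 2 * (N * h) ≤ 2 * L * h ^ 2 * 1 := by gcongr; linarith
    linarith
  rw [show (m + 1) * h + N * h = 1 by linarith] at h1
  have e4 : (∫ t in c..((m + 1) * h), φ t) + (∫ t in ((m + 1) * h)..1, φ t) =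
      ∫ t in c..1, φ t := by
    apply intervalIntegral.integral_add_adjacent_intervals
    · apply (H.continuousOn.mono _).intervalIntegrable
      rw [Set.uIcc_of_le (by linarith)]
      exact Set.Icc_subset_Icc le_rfl hx1
    · apply (H.continuousOn.mono _).intervalIntegrable
      rw [Set.uIcc_of_le (by linarith)]
      exact Set.Icc_subset_Icc hm' le_rfl
  have e5 : |h * (φ ((m + 1) * h) - φ c) / 2| ≤ h * (L * h) / 2 := by
    rw [abs_div, abs_mul, abs_of_pos hh, abs_two]
    gcongr
    linarith
  set S := ∑ k ∈ Finset.range N, φ ((m + 1) * h + (k + 1 : ℕ) * h)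
  have key : |h * (φ ((m + 1) * h) + S - h⁻¹ * (∫ t in c..1, φ t) +
      (m + 1 - h⁻¹ * c) * φ c - (φ 1 + φ c) / 2)| ≤ h * (4 * L * h) := by
    have : h * (φ ((m + 1) * h) + S - h⁻¹ * (∫ t in c..1, φ t) +
        (m + 1 - h⁻¹ * c) * φ c - (φ 1 + φ c) / 2) =
      h * φ ((m + 1) * h) + h * S - (∫ t in c..1, φ t) + ((m + 1) * h - c) * φ c
        - h * (φ 1 + φ c) / 2 := by
      field_simp
    rw [this, ← e4]
    have : 0 ≤ L * h ^ 2 := by positivity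
    rw [abs_le] at *
    constructor <;> linarith
  rw [abs_mul, abs_of_pos hh] at key
  exact le_of_mul_le_mul_left key hh

theorem abs_exp_neg_sub_le {a b : ℝ} (ha : 0 ≤ a) (hb : 0 ≤ b) :
    |Real.exp (-a) - Real.exp (-b)| ≤ |a - b| := by
  have key : ∀ {a b : ℝ}, 0 ≤ a → Real.exp (-a) - Real.exp (-b) ≤ |a - b| := by
    intro a b ha
    have h1 : Real.exp (-b) = Real.exp (-a) * Real.exp (a - b) := by
      rw [← Real.exp_add]; ring_nf
    have h2 := Real.add_one_le_exp (a - b)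
    have h3 : Real.exp (-a) ≤ 1 := Real.exp_le_one_iff.2 (by linarith)
    have h4 := Real.exp_pos (-a)
    have h5 := neg_abs_le (a - b)
    have h6 : Real.exp (-a) * (1 - Real.exp (a - b)) ≤ Real.exp (-a) * |a - b| := by
      gcongr; linarith
    have h7 : Real.exp (-a) * |a - b| ≤ 1 * |a - b| := by gcongr
    rw [h1]; linarith
  rw [abs_le]
  constructor
  · have := key (b := a) hb
    rw [abs_sub_comm] at this; linarith
  · exact key ha

theorem IsSmoothBranch.exp_neg_mem {φ φ' : ℝ → ℝ} {a b L κ x : ℝ}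
    (H : IsSmoothBranch φ φ' a b L κ) (hx : x ∈ Set.Icc a b) :
    0 < Real.exp (-φ x) ∧ Real.exp (-φ x) ≤ Real.exp (-κ) :=
  ⟨Real.exp_pos _, Real.exp_le_exp.2 (neg_le_neg (H.lower x hx))⟩

theorem IsSmoothBranch.abs_exp_neg_sub_le {φ φ' : ℝ → ℝ} {a b L κ x y : ℝ}
    (H : IsSmoothBranch φ φ' a b L κ) (hκ : 0 ≤ κ) (hx : x ∈ Set.Icc a b) (hy : y ∈ Set.Icc a b) :
    |Real.exp (-φ y) - Real.exp (-φ x)| ≤ L * |y - x| :=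
  (_root_.abs_exp_neg_sub_le (hκ.trans (H.lower y hy)) (hκ.trans (H.lower x hx))).trans
    (H.lipschitz x hx y hy)

theorem exists_log_Dn_approx {φ0 φ0' φ1 φ1' f : ℝ → ℝ} {c L κ h : ℝ}
    (H0 : IsSmoothBranch φ0 φ0' 0 c L κ) (H1 : IsSmoothBranch φ1 φ1' c 1 L κ)
    (hκ : 0 < κ) (hL : 0 ≤ L) (hc0 : 0 ≤ c) (hc1 : c ≤ 1)
    (hf0 : ∀ x ∈ Set.Ico 0 c, f x = Real.exp (-φ0 x) + (Real.exp (-φ0 x))⁻¹)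
    (hf1 : ∀ x ∈ Set.Icc c 1, f x = Real.exp (-φ1 x) + (Real.exp (-φ1 x))⁻¹)
    {n m N : ℕ} (hn : n = m + 1 + N) (hh : h = (n : ℝ)⁻¹) (hm : m * h < c)
    (hm' : c ≤ (m + 1) * h) :
    ∃ um wm ur wn : ℝ, 0 < Dn f n ∧ |um - Real.exp (-φ0 c)| ≤ L * h ∧
      |ur - Real.exp (-φ1 c)| ≤ L * h ∧
      |um - wm| ≤ Real.exp (-κ) ^ m + L * h / (1 - Real.exp (-κ)) ∧
      |Real.exp (-φ1 1) - wn| ≤ Real.exp (-κ) ^ N + L * h / (1 - Real.exp (-κ)) ∧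
      |Real.log (Dn f n) - n * ((∫ t in (0 : ℝ)..c, φ0 t) + ∫ t in c..1, φ1 t)
        - (n * c - m) * (φ1 c - φ0 c)
        - ((φ0 c - φ0 0) / 2 + (φ1 1 + φ1 c) / 2 - φ1 c
          + (- Real.log (1 - um * wm)
            + (Real.log (1 - um ^ 2) - Real.log (1 - Real.exp (-φ0 0) ^ 2)) / 2
            + Real.log (1 - ur * wm) - Real.log (1 - Real.exp (-φ1 1) * wn)
            + (Real.log (1 - Real.exp (-φ1 1) ^ 2) - Real.log (1 - ur ^ 2)) / 2))| ≤
      (8 * L + 6 / (1 - Real.exp (-κ)) ^ 4 * L * (1 + L)) * h := by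
  set ρ := Real.exp (-κ) with hρ_def
  have hρ : ρ < 1 := Real.exp_lt_one_iff.2 (by linarith)
  have hρ0 : 0 < ρ := Real.exp_pos _
  have hn0 : (0 : ℝ) < n := by rw [hn]; positivity
  have hh0 : 0 < h := by rw [hh]; positivity
  have hnh : (m + 1 + N) * h = 1 := by
    rw [hh, hn]; push_cast
    rw [hn] at hn0; push_cast at hn0
    exact mul_inv_cancel₀ hn0.ne'
  have hNh : 0 ≤ (N : ℝ) * h := by positivity
  have hmh : 0 ≤ (m : ℝ) * h := by positivity
  have h1m : (m + 1) * h ≤ 1 := by linarith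
  set w := minorRatio fun k => f (k * h) with hw_def
  have w0 : w 0 = 0 := rfl
  have wS : ∀ k : ℕ, w (k + 1) = (f ((k + 1 : ℕ) * h) - w k)⁻¹ := fun k => rfl
  set u : ℕ → ℝ := fun k => Real.exp (-φ0 (k * h)) with hu_def
  set v : ℕ → ℝ := fun k => Real.exp (-φ1 ((m + 1) * h + k * h)) with hv_def
  have memL : ∀ k : ℕ, k ≤ m → (k : ℝ) * h ∈ Set.Ico 0 c := by
    intro k hk
    refine ⟨by positivity, lt_of_le_of_lt ?_ hm⟩
    gcongr
  have memR : ∀ k : ℕ, k ≤ N → (m + 1) * h + (k : ℝ) * h ∈ Set.Icc c 1 := by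
    intro k hk
    have h1 : (0 : ℝ) ≤ k * h := by positivity
    have h2 : (k : ℝ) * h ≤ N * h := by gcongr
    constructor <;> linarith
  have hu : ∀ k ≤ m, 0 < u k ∧ u k ≤ ρ := fun k hk =>
    H0.exp_neg_mem (Set.Ico_subset_Icc_self (memL k hk))
  have hv : ∀ k ≤ N, 0 < v k ∧ v k ≤ ρ := fun k hk => H1.exp_neg_mem (memR k hk)
  have recL : ∀ k < m, w (k + 1) = (u (k + 1) + (u (k + 1))⁻¹ - w k)⁻¹ := by
    intro k hk
    rw [wS, hf0 _ (memL (k + 1) hk)]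
  have recR : ∀ k ≤ N, w (m + 1 + k) = (v k + (v k)⁻¹ - w (m + k))⁻¹ := by
    intro k hk
    rw [show m + 1 + k = m + k + 1 by ring, wS, ← hf1 _ (memR k hk)]
    congr 4
    push_cast; ring
  have hwL : ∀ k ≤ m, 0 ≤ w k ∧ w k ≤ ρ ∧ (w k = 0 → k = 0) := by
    intro k
    induction k with
    | zero => intro _; rw [w0]; exact ⟨le_rfl, hρ0.le, fun _ => rfl⟩
    | succ k ih =>
      intro hk
      obtain ⟨i1, i2, -⟩ := ih (by omega)
      obtain ⟨s1, s2, -, -⟩ := minorRatio_step hρ (hu _ hk).1 (hu _ hk).2 i1 i2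
      rw [recL k hk]
      exact ⟨s1.le, s2, fun h' => absurd h' s1.ne'⟩
  have hwR : ∀ k ≤ N, 0 < w (m + 1 + k) ∧ w (m + 1 + k) ≤ ρ := by
    intro k
    induction k with
    | zero =>
      intro hk
      obtain ⟨s1, s2, -, -⟩ := minorRatio_step hρ (hv _ hk).1 (hv _ hk).2 (hwL m le_rfl).1
        (hwL m le_rfl).2.1
      rw [recR 0 hk]
      exact ⟨s1, s2⟩
    | succ k ih =>
      intro hk
      obtain ⟨i1, i2⟩ := ih (by omega)
      rw [show m + 1 + k = m + (k + 1) by ring] at i1 i2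
      obtain ⟨s1, s2, -, -⟩ := minorRatio_step hρ (hv _ hk).1 (hv _ hk).2 i1.le i2
      rw [recR (k + 1) hk]
      exact ⟨s1, s2⟩
  have recR' : ∀ k < N, w (m + 1 + (k + 1)) = (v (k + 1) + (v (k + 1))⁻¹ - w (m + 1 + k))⁻¹ := by
    intro k hk
    rw [recR (k + 1) hk, show m + 1 + k = m + (k + 1) by ring]
  have incL : ∀ k < m, |u (k + 1) - u k| ≤ L * h := by
    intro k hk
    have := H0.abs_exp_neg_sub_le hκ.le (Set.Ico_subset_Icc_self (memL k hk.le))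
      (Set.Ico_subset_Icc_self (memL (k + 1) hk))
    rwa [show ((k + 1 : ℕ) : ℝ) * h - k * h = h by push_cast; ring, abs_of_pos hh0] at this
  have incR : ∀ k < N, |v (k + 1) - v k| ≤ L * h := by
    intro k hk
    have := H1.abs_exp_neg_sub_le hκ.le (memR k hk.le) (memR (k + 1) hk)
    rwa [show (m + 1) * h + ((k + 1 : ℕ) : ℝ) * h - ((m + 1) * h + k * h) = h by push_cast; ring,
      abs_of_pos hh0] at this
  have hLh : 0 ≤ L * h := by positivity
  have vN : v N = Real.exp (-φ1 1) := by
    simp only [hv_def]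
    rw [show (m + 1) * h + N * h = 1 by linarith]
  have v0 : v 0 = Real.exp (-φ1 ((m + 1) * h)) := by simp [hv_def]
  have u0 : u 0 = Real.exp (-φ0 0) := by simp [hu_def]
  have pos : ∀ k < n, 0 < w (k + 1) := by
    intro k hk
    rcases Nat.lt_or_ge k m with hkm | hkm
    · obtain ⟨i1, -, i3⟩ := hwL (k + 1) hkm
      exact lt_of_le_of_ne i1 fun h' => by have := i3 h'.symm; omega
    · obtain ⟨j, rfl⟩ := Nat.exists_eq_add_of_le hkm
      rw [show m + j + 1 = m + 1 + j by ring]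
      exact (hwR j (by omega)).1
  have hdet : Dn f n = ∏ k ∈ Finset.range n, (w (k + 1))⁻¹ := by
    rw [← det_tridiag_eq_prod]
    · unfold Dn
      congr 1
      ext i j
      simp only [Tmat, tridiag, Matrix.of_apply, hh, div_eq_mul_inv]
      push_cast; rfl
    · intro k hk h0
      by_contra hne
      obtain ⟨j, rfl⟩ := Nat.exists_eq_succ_of_ne_zero hne
      exact (pos j (by omega)).ne' h0
  have hD : 0 < Dn f n := by
    rw [hdet]
    exact Finset.prod_pos fun k hk => inv_pos.2 (pos k (Finset.mem_range.1 hk))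
  have hlog : Real.log (Dn f n) = - (∑ k ∈ Finset.range m, Real.log (w (k + 1)))
      - Real.log (w (m + 1)) - ∑ k ∈ Finset.range N, Real.log (w (m + 1 + (k + 1))) := by
    rw [hdet, Real.log_prod fun k hk => (inv_pos.2 (pos k (Finset.mem_range.1 hk))).ne', hn,
      Finset.sum_range_add, Finset.sum_range_succ]
    simp only [Real.log_inv, Finset.sum_neg_distrib, add_assoc]
    ring
  have hwL' : ∀ k ≤ m, 0 ≤ w k ∧ w k ≤ ρ := fun k hk => ⟨(hwL k hk).1, (hwL k hk).2.1⟩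
  have hwR' : ∀ k ≤ N, 0 ≤ w (m + 1 + k) ∧ w (m + 1 + k) ≤ ρ :=
    fun k hk => ⟨(hwR k hk).1.le, (hwR k hk).2⟩
  have A1 := abs_sum_log_sub_le hρ hLh hu hwL' recL incL
  have A2 := abs_sum_log_sub_le (w := fun k => w (m + 1 + k)) hρ hLh hv hwR' recR' incR
  obtain ⟨-, -, -, J⟩ := minorRatio_step hρ (hv 0 (Nat.zero_le _)).1 (hv 0 (Nat.zero_le _)).2
    (hwL' m le_rfl).1 (hwL' m le_rfl).2
  rw [show m = m + 0 from rfl, ← recR 0 (Nat.zero_le _)] at J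
  simp only [add_zero] at J A2
  have R1 := H0.abs_sum_left_le hL hc1 hh0 hm.le hm'
  have R2 := H1.abs_sum_right_le hL hc0 hh0 hm.le hm' hnh
  have hninv : h⁻¹ = n := by rw [hh, inv_inv]
  rw [hninv] at R1 R2
  have lu : ∀ k, Real.log (u k) = -φ0 (k * h) := fun k => Real.log_exp _
  have lv : ∀ k, Real.log (v k) = -φ1 ((m + 1) * h + k * h) := fun k => Real.log_exp _
  have lv0 : Real.log (v 0) = -φ1 ((m + 1) * h) := by rw [v0, Real.log_exp]
  rw [lv0] at J
  rw [Finset.sum_sub_distrib] at A1 A2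
  simp only [lu, lv, Finset.sum_neg_distrib] at A1 A2
  rw [w0, mul_zero, sub_zero, Real.log_one] at A1
  have bnd : ∀ K : ℕ, (K : ℝ) * h ≤ 1 → 3 / (1 - ρ) ^ 4 * (L * h) * (1 + K * (L * h)) ≤
      3 / (1 - ρ) ^ 4 * L * (1 + L) * h := by
    intro K hK
    have : K * (L * h) ≤ L := by nlinarith
    have h1 : 0 < 1 - ρ := by linarith
    calc _ ≤ 3 / (1 - ρ) ^ 4 * (L * h) * (1 + L) := by gcongr
      _ = _ := by ring
  have B1 := A1.trans (bnd m (by linarith))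
  have B2 := A2.trans (bnd N (by linarith))
  refine ⟨u m, w m, v 0, w (m + 1 + N), hD, ?_, ?_, ?_, ?_, ?_⟩
  · refine (H0.abs_exp_neg_sub_le hκ.le ⟨hc0, le_rfl⟩ ⟨hmh, hm.le⟩).trans ?_
    gcongr
    rw [abs_le]; constructor <;> linarith
  · rw [v0]
    refine (H1.abs_exp_neg_sub_le hκ.le ⟨le_rfl, hc1⟩ ⟨hm', h1m⟩).trans ?_
    gcongr
    rw [abs_le]; constructor <;> linarith
  · exact abs_sub_minorRatio_le hρ hLh hu hwL' recL incL
  · rw [← vN]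
    exact abs_sub_minorRatio_le (w := fun k => w (m + 1 + k)) hρ hLh hv hwR' recR' incR
  · rw [hlog]
    rw [u0] at B1
    rw [vN] at B2
    simp only [div_eq_mul_inv _ ((1 - ρ) ^ 4)] at B1 B2 ⊢
    rw [abs_le] at *
    constructor <;> linarith

theorem tendsto_log_Dn {φ0 φ0' φ1 φ1' f : ℝ → ℝ} {c L κ : ℝ}
    (H0 : IsSmoothBranch φ0 φ0' 0 c L κ) (H1 : IsSmoothBranch φ1 φ1' c 1 L κ)
    (hκ : 0 < κ) (hL : 0 ≤ L) (hc0 : 0 < c) (hc1 : c < 1)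
    (hf0 : ∀ x ∈ Set.Ico 0 c, f x = Real.exp (-φ0 x) + (Real.exp (-φ0 x))⁻¹)
    (hf1 : ∀ x ∈ Set.Icc c 1, f x = Real.exp (-φ1 x) + (Real.exp (-φ1 x))⁻¹) :
    (∀ n : ℕ, 0 < n → 0 < Dn f n) ∧
    Tendsto (fun n : ℕ => Real.log (Dn f n)
      - n * ((∫ t in (0 : ℝ)..c, φ0 t) + ∫ t in c..1, φ1 t)
      - (n * c - (⌈n * c⌉₊ - 1 : ℕ)) * (φ1 c - φ0 c)) atTop
      (𝓝 ((φ1 1 - φ0 0) / 2 - (φ1 c - φ0 c) / 2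
        + Real.log (1 - Real.exp (-φ1 c) * Real.exp (-φ0 c))
        - (Real.log (1 - Real.exp (-φ0 0) ^ 2) + Real.log (1 - Real.exp (-φ0 c) ^ 2)
          + Real.log (1 - Real.exp (-φ1 c) ^ 2) + Real.log (1 - Real.exp (-φ1 1) ^ 2)) / 2)) := by
  have hceil : ∀ n : ℕ, 0 < n → 1 ≤ ⌈n * c⌉₊ ∧ ⌈n * c⌉₊ ≤ n := by
    intro n hn
    have hn' : (0 : ℝ) < n := by exact_mod_cast hn
    refine ⟨Nat.one_le_iff_ne_zero.2 (Nat.ceil_pos.2 (by positivity)).ne', Nat.ceil_le.2 ?_⟩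
    nlinarith
  have hceil' : ∀ n : ℕ, (n : ℝ) * c ≤ ⌈n * c⌉₊ ∧ (⌈n * c⌉₊ : ℝ) < n * c + 1 := fun n =>
    ⟨Nat.le_ceil _, Nat.ceil_lt_add_one (by positivity)⟩
  have approx : ∀ n : ℕ, 0 < n → _ := fun n hn =>
    exists_log_Dn_approx (h := (n : ℝ)⁻¹) (n := n) (m := ⌈n * c⌉₊ - 1) (N := n - ⌈n * c⌉₊)
      H0 H1 hκ hL hc0.le hc1.le hf0 hf1 (by have := hceil n hn; omega) rfl
      (by
        have hn' : (0 : ℝ) < n := by exact_mod_cast hn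
        rw [Nat.cast_sub (hceil n hn).1, ← div_eq_mul_inv, div_lt_iff₀ hn']
        have := hceil' n
        push_cast; linarith)
      (by
        have hn' : (0 : ℝ) < n := by exact_mod_cast hn
        rw [Nat.cast_sub (hceil n hn).1, ← div_eq_mul_inv, le_div_iff₀ hn']
        have := hceil' n
        push_cast; linarith)
  choose! um wm ur wn hD h1 h2 h3 h4 h5 using approx
  refine ⟨hD, ?_⟩
  have hρ : Real.exp (-κ) < 1 := Real.exp_lt_one_iff.2 (by linarith)
  have hinv : Tendsto (fun n : ℕ => (n : ℝ)⁻¹) atTop (𝓝 0) := tendsto_inv_atTop_nhds_zero_nat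
  have tm : Tendsto (fun n : ℕ => ⌈n * c⌉₊ - 1) atTop atTop := by
    have h : Tendsto (fun n : ℕ => ⌈n * c⌉₊) atTop atTop :=
      tendsto_nat_ceil_atTop.comp (tendsto_natCast_atTop_atTop.atTop_mul_const hc0)
    exact (tendsto_sub_atTop_nat 1).comp h
  have tN : Tendsto (fun n : ℕ => n - ⌈n * c⌉₊) atTop atTop := by
    rw [← tendsto_natCast_atTop_iff (R := ℝ)]
    have h : Tendsto (fun n : ℕ => (n : ℝ) * (1 - c) - 1) atTop atTop :=
      tendsto_atTop_add_const_right _ _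
        (tendsto_natCast_atTop_atTop.atTop_mul_const (by linarith))
    refine tendsto_atTop_mono' _ ?_ h
    filter_upwards [eventually_gt_atTop 0] with n hn
    rw [Nat.cast_sub (hceil n hn).2]
    have := hceil' n
    linarith
  have tL : Tendsto (fun n : ℕ => L * (n : ℝ)⁻¹) atTop (𝓝 0) := by
    simpa using hinv.const_mul L
  have tpow : ∀ {k : ℕ → ℕ}, Tendsto k atTop atTop → Tendsto (fun n : ℕ =>
      Real.exp (-κ) ^ k n + L * (n : ℝ)⁻¹ / (1 - Real.exp (-κ))) atTop (𝓝 0) := by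
    intro k hk
    simpa using ((tendsto_pow_atTop_nhds_zero_of_lt_one (Real.exp_pos _).le hρ).comp hk).add
      (tL.div_const (1 - Real.exp (-κ)))
  have conv : ∀ {F B : ℕ → ℝ}, (∀ n, 0 < n → |F n| ≤ B n) → Tendsto B atTop (𝓝 0) →
      Tendsto F atTop (𝓝 0) := by
    intro F B hFB hB
    exact squeeze_zero_norm' (by filter_upwards [eventually_gt_atTop 0] with n hn using hFB n hn) hB
  have l1 : Tendsto um atTop (𝓝 (Real.exp (-φ0 c))) :=
    tendsto_sub_nhds_zero_iff.1 (conv h1 tL)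
  have l2 : Tendsto ur atTop (𝓝 (Real.exp (-φ1 c))) :=
    tendsto_sub_nhds_zero_iff.1 (conv h2 tL)
  have l3 : Tendsto wm atTop (𝓝 (Real.exp (-φ0 c))) := by
    simpa using l1.sub (conv h3 (tpow tm))
  have l4 : Tendsto wn atTop (𝓝 (Real.exp (-φ1 1))) := by
    simpa using (tendsto_const_nhds (x := Real.exp (-φ1 1))).sub (conv h4 (tpow tN))
  have l5 := conv h5 (by simpa using hinv.const_mul _)
  have lt1 : ∀ {φ φ' : ℝ → ℝ} {a b x y : ℝ} {ψ ψ' : ℝ → ℝ} {a' b' : ℝ},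
      IsSmoothBranch φ φ' a b L κ → x ∈ Set.Icc a b →
      IsSmoothBranch ψ ψ' a' b' L κ → y ∈ Set.Icc a' b' →
      (1 - Real.exp (-φ x) * Real.exp (-ψ y)) ≠ 0 := by
    intro φ φ' a b x y ψ ψ' a' b' H hx H' hy
    have := H.exp_neg_mem hx
    have := H'.exp_neg_mem hy
    nlinarith
  have c0 : c ∈ Set.Icc 0 c := ⟨hc0.le, le_rfl⟩
  have c1 : c ∈ Set.Icc c 1 := ⟨le_rfl, hc1.le⟩
  have o1 : (1 : ℝ) ∈ Set.Icc c 1 := ⟨hc1.le, le_rfl⟩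
  have g1 := ((l1.mul l3).const_sub 1).log (lt1 H0 c0 H0 c0)
  have g2 := ((l1.pow 2).const_sub 1).log (by rw [pow_two]; exact lt1 H0 c0 H0 c0)
  have g3 := ((l2.mul l3).const_sub 1).log (lt1 H1 c1 H0 c0)
  have g4 := ((l4.const_mul (Real.exp (-φ1 1))).const_sub 1).log (lt1 H1 o1 H1 o1)
  have g5 := ((l2.pow 2).const_sub 1).log (by rw [pow_two]; exact lt1 H1 c1 H1 c1)
  have g6 := (((((g1.neg.add ((g2.sub_const (Real.log (1 - Real.exp (-φ0 0) ^ 2))).div_const 2)).add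
    g3).sub g4).add ((g5.const_sub (Real.log (1 - Real.exp (-φ1 1) ^ 2))).div_const 2)).const_add
    ((φ0 c - φ0 0) / 2 + (φ1 1 + φ1 c) / 2 - φ1 c)).add l5
  convert g6 using 2
  · ring
  · simp only [← pow_two]; ring

theorem limsup_liminf_mul_eq {a s : ℕ → ℝ} {Q l r : ℝ} (hQ : 0 < Q)
    (ha : Tendsto a atTop (𝓝 Q)) (hs : ∀ᶠ n in atTop, l ≤ s n ∧ s n ≤ r)
    (hfl : ∃ᶠ n in atTop, s n = l) (hfr : ∃ᶠ n in atTop, s n = r) :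
    limsup (fun n => a n * s n) atTop = Q * r ∧ liminf (fun n => a n * s n) atTop = Q * l := by
  have hpos : ∀ᶠ n in atTop, 0 < a n := ha.eventually_const_lt hQ
  have hup : ∀ᶠ n in atTop, a n * s n ≤ a n * r := by
    filter_upwards [hpos, hs] with n h1 h2
    exact mul_le_mul_of_nonneg_left h2.2 h1.le
  have hlo : ∀ᶠ n in atTop, a n * l ≤ a n * s n := by
    filter_upwards [hpos, hs] with n h1 h2
    exact mul_le_mul_of_nonneg_left h2.1 h1.le
  have tr := ha.mul_const r
  have tl := ha.mul_const l
  have bA : IsBoundedUnder (· ≤ ·) atTop fun n => a n * s n := tr.isBoundedUnder_le.mono_le hup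
  have bB : IsBoundedUnder (· ≥ ·) atTop fun n => a n * s n := tl.isBoundedUnder_ge.mono_ge hlo
  refine ⟨le_antisymm (le_of_forall_gt_imp_ge_of_dense fun x hx => ?_)
      (le_of_forall_lt_imp_le_of_dense fun x hx => ?_),
    le_antisymm (le_of_forall_gt_imp_ge_of_dense fun x hx => ?_)
      (le_of_forall_lt_imp_le_of_dense fun x hx => ?_)⟩
  · refine limsup_le_of_le bB.isCoboundedUnder_le ?_
    filter_upwards [hup, tr.eventually_lt_const hx] with n h1 h2
    exact h1.trans h2.le
  · refine le_limsup_of_frequently_le ?_ bA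
    refine (hfr.and_eventually (tr.eventually_const_lt hx)).mono fun n h => ?_
    rw [h.1]; exact h.2.le
  · refine liminf_le_of_frequently_le ?_ bB
    refine (hfl.and_eventually (tl.eventually_lt_const hx)).mono fun n h => ?_
    rw [h.1]; exact h.2.le
  · refine le_liminf_of_le bA.isCoboundedUnder_ge ?_
    filter_upwards [hlo, tl.eventually_const_lt hx] with n h1 h2
    exact h2.le.trans h1

/-- The offset of the rational jump `p / q` from the last node `k / n` before it, in units of
`1 / n`, takes values in `[1 / q, 1]`, and attains both endpoints infinitely often. -/
theorem rational_jump_offset {p q : ℕ} (hp : 0 < p) (hq : 1 < q) (hpq : Nat.Coprime p q) :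
    (∀ n : ℕ, 0 < n →
      1 / (q : ℝ) ≤ n * ((p : ℝ) / q) - (⌈n * ((p : ℝ) / q)⌉₊ - 1 : ℕ) ∧
      n * ((p : ℝ) / q) - (⌈n * ((p : ℝ) / q)⌉₊ - 1 : ℕ) ≤ 1) ∧
    (∃ᶠ n : ℕ in atTop, n * ((p : ℝ) / q) - (⌈n * ((p : ℝ) / q)⌉₊ - 1 : ℕ) = 1 / q) ∧
    ∃ᶠ n : ℕ in atTop, n * ((p : ℝ) / q) - (⌈n * ((p : ℝ) / q)⌉₊ - 1 : ℕ) = 1 := by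
  have hq0 : (0 : ℝ) < q := by exact_mod_cast (by omega : 0 < q)
  have hp0 : (0 : ℝ) < p := by exact_mod_cast hp
  have hq1 : (1 : ℝ) < q := by exact_mod_cast hq
  have off : ∀ (n k : ℕ) (t : ℝ), 0 < t → t ≤ 1 → n * ((p : ℝ) / q) = k + t →
      n * ((p : ℝ) / q) - (⌈n * ((p : ℝ) / q)⌉₊ - 1 : ℕ) = t := by
    intro n k t ht0 ht1 h
    have : ⌈n * ((p : ℝ) / q)⌉₊ = k + 1 := by
      rw [Nat.ceil_eq_iff (by omega), h]
      push_cast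
      constructor
      · simp [ht0]
      · linarith
    rw [this, h]; simp
  refine ⟨fun n hn => ?_, ?_, ?_⟩
  · have hn' : (0 : ℝ) < n := by exact_mod_cast hn
    have hpos : 1 ≤ ⌈n * ((p : ℝ) / q)⌉₊ :=
      Nat.one_le_iff_ne_zero.2 (Nat.ceil_pos.2 (by positivity)).ne'
    have h1 := Nat.le_ceil (n * ((p : ℝ) / q))
    have h2 := Nat.ceil_lt_add_one (a := n * ((p : ℝ) / q)) (by positivity)
    set k := ⌈n * ((p : ℝ) / q)⌉₊
    rw [Nat.cast_sub hpos]
    push_cast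
    constructor
    · have h3 : ((q * k : ℕ) : ℝ) < ((n * p + q : ℕ) : ℝ) := by
        push_cast
        have : n * ((p : ℝ) / q) + 1 = (n * p + q) / q := by field_simp
        rw [this, lt_div_iff₀ hq0] at h2
        linarith
      have h4 : q * k + 1 ≤ n * p + q := by exact_mod_cast h3
      have h5 : (q : ℝ) * k + 1 ≤ n * p + q := by exact_mod_cast h4
      have : n * ((p : ℝ) / q) - (k - 1) - 1 / q = (n * p + q - q * k - 1) / q := by
        field_simp; ring
      have : 0 ≤ (n * p + q - q * k - 1) / (q : ℝ) := div_nonneg (by linarith) hq0.le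
      linarith
    · linarith
  · obtain ⟨r, -, hr⟩ := Nat.exists_mul_mod_eq_one_of_coprime hpq hq
    rw [frequently_atTop]
    intro a
    refine ⟨r + q * a, by nlinarith, ?_⟩
    have h := Nat.div_add_mod (p * r) q
    rw [hr] at h
    refine off _ (p * r / q + p * a) _ (by positivity)
      (by rw [div_le_one hq0]; exact hq1.le) ?_
    have h' : (q : ℝ) * (p * r / q : ℕ) + 1 = p * r := by exact_mod_cast h
    push_cast
    field_simp
    linarith
  · rw [frequently_atTop]
    intro a
    refine ⟨q * (a + 1), by nlinarith, ?_⟩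
    refine off _ (p * (a + 1) - 1) 1 one_pos le_rfl ?_
    rw [Nat.cast_sub (by nlinarith)]
    push_cast
    field_simp
    ring

/-- The logarithm of the larger root of `X ^ 2 - t X + 1`. -/
noncomputable def logRoot (t : ℝ) : ℝ := Real.log ((t + Real.sqrt (t ^ 2 - 4)) / 2)

theorem exp_logRoot {t : ℝ} (ht : 2 < t) :
    Real.exp (logRoot t) = (t + Real.sqrt (t ^ 2 - 4)) / 2 :=
  Real.exp_log (by positivity)

theorem exp_neg_logRoot {t : ℝ} (ht : 2 < t) :
    Real.exp (-logRoot t) = (t - Real.sqrt (t ^ 2 - 4)) / 2 := by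
  have hs := Real.sq_sqrt (by nlinarith : 0 ≤ t ^ 2 - 4)
  rw [Real.exp_neg, exp_logRoot ht]
  have := Real.sqrt_nonneg (t ^ 2 - 4)
  rw [inv_eq_one_div, div_eq_iff (by positivity)]
  linarith

theorem log_sqrt_eq {t : ℝ} (ht : 2 < t) :
    Real.log (Real.sqrt (t ^ 2 - 4)) =
      logRoot t + Real.log (1 - Real.exp (-logRoot t) ^ 2) := by
  have h : 0 < t ^ 2 - 4 := by nlinarith
  have hs := Real.sqrt_pos.2 h
  have e : Real.sqrt (t ^ 2 - 4) =
      Real.exp (logRoot t) * (1 - Real.exp (-logRoot t) ^ 2) := by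
    have h1 : Real.exp (logRoot t) * Real.exp (-logRoot t) = 1 := by rw [← Real.exp_add]; simp
    calc _ = Real.exp (logRoot t) - Real.exp (-logRoot t) := by
            rw [exp_logRoot ht, exp_neg_logRoot ht]; ring
      _ = Real.exp (logRoot t) -
          (Real.exp (logRoot t) * Real.exp (-logRoot t)) * Real.exp (-logRoot t) := by
            rw [h1, one_mul]
      _ = _ := by ring
  have h2 : 1 - Real.exp (-logRoot t) ^ 2 ≠ 0 := by
    intro h0
    rw [h0, mul_zero] at e
    exact hs.ne' e
  conv_lhs => rw [e]
  rw [Real.log_mul (Real.exp_pos _).ne' h2, Real.log_exp]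

theorem log_quarter_power {s t : ℝ} (hs : 2 < s) (ht : 2 < t) :
    Real.log (((s ^ 2 - 4) * (t ^ 2 - 4)) ^ ((1 : ℝ) / 4)) =
      (logRoot s + Real.log (1 - Real.exp (-logRoot s) ^ 2) + logRoot t
        + Real.log (1 - Real.exp (-logRoot t) ^ 2)) / 2 := by
  have h1 : 0 < s ^ 2 - 4 := by nlinarith
  have h2 : 0 < t ^ 2 - 4 := by nlinarith
  have e1 := log_sqrt_eq hs
  have e2 := log_sqrt_eq ht
  rw [Real.log_sqrt h1.le] at e1
  rw [Real.log_sqrt h2.le] at e2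
  rw [Real.log_rpow (by positivity), Real.log_mul h1.ne' h2.ne']
  linarith

theorem logRoot_pos {t : ℝ} (ht : 2 < t) : 0 < logRoot t := by
  have := Real.sqrt_nonneg (t ^ 2 - 4)
  exact Real.log_pos (by linarith)

theorem jump_constant_eq_exp {x y s t : ℝ} (hx : 2 < x) (hy : 2 < y) (hs : 2 < s) (ht : 2 < t) :
    ((1/2) * (y + Real.sqrt (y ^ 2 - 4)) / ((x ^ 2 - 4) * (y ^ 2 - 4)) ^ ((1:ℝ)/4)) *
      ((s - t + Real.sqrt (t ^ 2 - 4) + Real.sqrt (s ^ 2 - 4)) /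
        (2 * ((t ^ 2 - 4) * (s ^ 2 - 4)) ^ ((1:ℝ)/4))) =
    Real.exp ((logRoot y - logRoot x) / 2 - (logRoot t - logRoot s) / 2
        + Real.log (1 - Real.exp (-logRoot t) * Real.exp (-logRoot s))
        - (Real.log (1 - Real.exp (-logRoot x) ^ 2) + Real.log (1 - Real.exp (-logRoot s) ^ 2)
          + Real.log (1 - Real.exp (-logRoot t) ^ 2)
          + Real.log (1 - Real.exp (-logRoot y) ^ 2)) / 2) := by
  have pp : ∀ {s t : ℝ}, 2 < s → 2 < t → 0 < ((s ^ 2 - 4) * (t ^ 2 - 4)) ^ ((1 : ℝ) / 4) := by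
    intro s t hs ht
    have h1 : 0 < s ^ 2 - 4 := by nlinarith
    have h2 : 0 < t ^ 2 - 4 := by nlinarith
    positivity
  have p1 := pp hx hy
  have p2 := pp ht hs
  have e1 : (1/2) * (y + Real.sqrt (y ^ 2 - 4)) = Real.exp (logRoot y) := by
    rw [exp_logRoot hy]; ring
  have hlt : 0 < 1 - Real.exp (-logRoot t) * Real.exp (-logRoot s) := by
    rw [← Real.exp_add, sub_pos, Real.exp_lt_one_iff]
    linarith [logRoot_pos hs, logRoot_pos ht]
  have e2 : s - t + Real.sqrt (t ^ 2 - 4) + Real.sqrt (s ^ 2 - 4) =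
      2 * (Real.exp (logRoot s) * (1 - Real.exp (-logRoot t) * Real.exp (-logRoot s))) := by
    have h1 : Real.exp (logRoot s) * Real.exp (-logRoot s) = 1 := by rw [← Real.exp_add]; simp
    calc _ = 2 * (Real.exp (logRoot s) - Real.exp (-logRoot t)) := by
            rw [exp_logRoot hs, exp_neg_logRoot ht]; ring
      _ = 2 * (Real.exp (logRoot s) -
          (Real.exp (logRoot s) * Real.exp (-logRoot s)) * Real.exp (-logRoot t)) := by
            rw [h1, one_mul]
      _ = _ := by ring
  rw [e1, e2, mul_div_mul_left _ _ two_ne_zero]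
  rw [← Real.exp_log (div_pos (Real.exp_pos (logRoot y)) p1),
    ← Real.exp_log (div_pos (mul_pos (Real.exp_pos (logRoot s)) hlt) p2), ← Real.exp_add]
  rw [Real.log_div (Real.exp_pos _).ne' p1.ne',
    Real.log_div (mul_pos (Real.exp_pos (logRoot s)) hlt).ne' p2.ne',
    Real.log_mul (Real.exp_pos _).ne' hlt.ne', Real.log_exp, Real.log_exp,
    log_quarter_power hx hy, log_quarter_power ht hs]
  congr 1
  ring

theorem hasDerivWithinAt_logRoot_comp {g : ℝ → ℝ} {g' x : ℝ} {s : Set ℝ} (hx : 2 < g x)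
    (hg : HasDerivWithinAt g g' s x) :
    HasDerivWithinAt (fun y => logRoot (g y)) (g' / Real.sqrt (g x ^ 2 - 4)) s x := by
  have h : 0 < g x ^ 2 - 4 := by nlinarith
  have hs := Real.sqrt_pos.2 h
  have h1 := ((hg.pow 2).sub_const 4).sqrt h.ne'
  have h2 := ((hg.add h1).div_const 2).log (by simp only [Pi.add_apply, Pi.pow_apply]; positivity)
  refine h2.congr_deriv ?_
  simp only [Pi.add_apply, Pi.pow_apply]
  field_simp
  push_cast
  ring

theorem exists_isSmoothBranch_logRoot {g g' g'' : ℝ → ℝ} {a b δ : ℝ} (hδ : 0 < δ)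
    (hd1 : ∀ x ∈ Set.Icc a b, HasDerivWithinAt g (g' x) (Set.Icc a b) x)
    (hd2 : ∀ x ∈ Set.Icc a b, HasDerivWithinAt g' (g'' x) (Set.Icc a b) x)
    (hbd : ∃ M : ℝ, ∀ x ∈ Set.Icc a b, |g'' x| ≤ M)
    (hg : ∀ x ∈ Set.Icc a b, 2 + δ ≤ g x) :
    ∃ φ' : ℝ → ℝ, ∃ L : ℝ, ∀ L' ≥ L,
      IsSmoothBranch (fun x => logRoot (g x)) φ' a b L' (Real.log (1 + δ / 2)) := by
  obtain ⟨M, hM⟩ := hbd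
  have hg2 : ∀ x ∈ Set.Icc a b, 2 < g x := fun x hx => by linarith [hg x hx]
  have hsq : ∀ x ∈ Set.Icc a b, 0 < g x ^ 2 - 4 := fun x hx => by nlinarith [hg2 x hx]
  have hs : ∀ x ∈ Set.Icc a b, 0 < Real.sqrt (g x ^ 2 - 4) := fun x hx => Real.sqrt_pos.2 (hsq x hx)
  have hgc : ContinuousOn g (Set.Icc a b) := fun x hx => (hd1 x hx).continuousWithinAt
  have hgc' : ContinuousOn g' (Set.Icc a b) := fun x hx => (hd2 x hx).continuousWithinAt
  have hsc : ContinuousOn (fun x => Real.sqrt (g x ^ 2 - 4)) (Set.Icc a b) :=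
    ((hgc.pow 2).sub continuousOn_const).sqrt
  have hφ : ∀ x ∈ Set.Icc a b, HasDerivWithinAt (fun x => logRoot (g x))
      (g' x / Real.sqrt (g x ^ 2 - 4)) (Set.Icc a b) x := fun x hx =>
    hasDerivWithinAt_logRoot_comp (hg2 x hx) (hd1 x hx)
  have hφ' : ∀ x ∈ Set.Icc a b, HasDerivWithinAt (fun x => g' x / Real.sqrt (g x ^ 2 - 4))
      (g'' x * (1 / Real.sqrt (g x ^ 2 - 4)) - g x * g' x ^ 2 / Real.sqrt (g x ^ 2 - 4) ^ 3)
      (Set.Icc a b) x := by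
    intro x hx
    have h1 := (hd2 x hx).div ((((hd1 x hx).pow 2).sub_const 4).sqrt (hsq x hx).ne') (hs x hx).ne'
    refine h1.congr_deriv ?_
    have := hs x hx
    simp only [Pi.pow_apply]
    field_simp
    push_cast
    ring
  obtain ⟨C1, hC1⟩ := isCompact_Icc.exists_bound_of_continuousOn
    ((continuousOn_const (c := (1 : ℝ))).div hsc fun x hx => (hs x hx).ne')
  obtain ⟨C2, hC2⟩ := isCompact_Icc.exists_bound_of_continuousOn
    ((hgc.mul (hgc'.pow 2)).div (hsc.pow 3) fun x hx => (pow_pos (hs x hx) 3).ne')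
  obtain ⟨C3, hC3⟩ := isCompact_Icc.exists_bound_of_continuousOn
    (hgc'.div hsc fun x hx => (hs x hx).ne')
  refine ⟨fun x => g' x / Real.sqrt (g x ^ 2 - 4), max (M * C1 + C2) C3, fun L' hL' => ?_⟩
  have bφ' : ∀ x ∈ Set.Icc a b, ‖g' x / Real.sqrt (g x ^ 2 - 4)‖ ≤ L' := fun x hx =>
    (hC3 x hx).trans ((le_max_right _ _).trans hL')
  have bφ'' : ∀ x ∈ Set.Icc a b, ‖g'' x * (1 / Real.sqrt (g x ^ 2 - 4)) -
      g x * g' x ^ 2 / Real.sqrt (g x ^ 2 - 4) ^ 3‖ ≤ L' := by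
    intro x hx
    refine le_trans ?_ ((le_max_left _ _).trans hL')
    refine (norm_sub_le _ _).trans (add_le_add ?_ (hC2 x hx))
    rw [norm_mul]
    exact mul_le_mul (hM x hx) (hC1 x hx) (norm_nonneg _) ((abs_nonneg _).trans (hM x hx))
  refine ⟨fun x hx => (hφ x hx).continuousWithinAt, ?_, ?_, ?_⟩
  · intro x hx y hy
    have hsub : Set.uIcc x y ⊆ Set.Icc a b := Set.uIcc_subset_Icc hx hy
    have key := Convex.norm_image_sub_le_of_norm_hasDerivWithin_le (s := Set.uIcc x y)
      (f := fun t => logRoot (g t) - t * (g' x / Real.sqrt (g x ^ 2 - 4)))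
      (f' := fun t => g' t / Real.sqrt (g t ^ 2 - 4) - 1 * (g' x / Real.sqrt (g x ^ 2 - 4)))
      (C := L' * |y - x|)
      (fun t ht => ((hφ t (hsub ht)).mono hsub).sub ((hasDerivWithinAt_id t _).mul_const _))
      (fun t ht => by
        rw [one_mul]
        refine (Convex.norm_image_sub_le_of_norm_hasDerivWithin_le hφ' bφ'' (convex_Icc a b) hx
          (hsub ht)).trans ?_
        have : 0 ≤ L' := (norm_nonneg _).trans (bφ' x hx)
        rw [Real.norm_eq_abs]
        exact mul_le_mul_of_nonneg_left (Set.abs_sub_left_of_mem_uIcc ht) this)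
      (convex_uIcc x y) Set.left_mem_uIcc Set.right_mem_uIcc
    rw [Real.norm_eq_abs, Real.norm_eq_abs, mul_assoc, ← pow_two, sq_abs] at key
    convert key using 2
    ring
  · intro x hx y hy
    exact Convex.norm_image_sub_le_of_norm_hasDerivWithin_le hφ bφ' (convex_Icc a b) hx hy
  · intro x hx
    have := hg x hx
    have := Real.sqrt_nonneg (g x ^ 2 - 4)
    exact Real.log_le_log (by positivity) (by linarith)

theorem add_inv_exp_neg_logRoot {t : ℝ} (ht : 2 < t) :
    t = Real.exp (-logRoot t) + (Real.exp (-logRoot t))⁻¹ := by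
  rw [← Real.exp_neg, neg_neg, exp_logRoot ht, exp_neg_logRoot ht]
  ring

theorem exp_mul_mem_Icc {q θ Δ : ℝ} (h1 : 1 / q ≤ θ) (h2 : θ ≤ 1) :
    min (Real.exp (1 / q * Δ)) (Real.exp Δ) ≤ Real.exp (θ * Δ) ∧
      Real.exp (θ * Δ) ≤ max (Real.exp (1 / q * Δ)) (Real.exp Δ) := by
  rcases le_total 0 Δ with h | h
  · exact ⟨min_le_of_left_le (Real.exp_le_exp.2 (by nlinarith)),
      le_max_of_le_right (Real.exp_le_exp.2 (by nlinarith))⟩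
  · exact ⟨min_le_of_right_le (Real.exp_le_exp.2 (by nlinarith)),
      le_max_of_le_left (Real.exp_le_exp.2 (by nlinarith))⟩

/-- limsup and liminf of D_n(f)/G(f)ⁿ for a symbol with a single jump at a rational
point c = p/q, right-continuous at c.  Here f(c−) = g₀(c) and f(c+) = g₁(c) = f(c). -/
theorem limsup_liminf_rational_jump
    (p q : ℕ) (hp : 0 < p) (hq : 0 < q) (hpq : Nat.Coprime p q)
    (c : ℝ) (hc : c = (p : ℝ) / (q : ℝ)) (hc0 : 0 < c) (hc1 : c < 1)
    (f g0 g0' g0'' g1 g1' g1'' : ℝ → ℝ)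
    (hd01 : ∀ x ∈ Set.Icc (0:ℝ) c, HasDerivWithinAt g0 (g0' x) (Set.Icc (0:ℝ) c) x)
    (hd02 : ∀ x ∈ Set.Icc (0:ℝ) c, HasDerivWithinAt g0' (g0'' x) (Set.Icc (0:ℝ) c) x)
    (hbd0 : ∃ M : ℝ, ∀ x ∈ Set.Icc (0:ℝ) c, |g0'' x| ≤ M)
    (hd11 : ∀ x ∈ Set.Icc c 1, HasDerivWithinAt g1 (g1' x) (Set.Icc c 1) x)
    (hd12 : ∀ x ∈ Set.Icc c 1, HasDerivWithinAt g1' (g1'' x) (Set.Icc c 1) x)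
    (hbd1 : ∃ M : ℝ, ∀ x ∈ Set.Icc c 1, |g1'' x| ≤ M)
    (hfg0 : ∀ x ∈ Set.Ico (0:ℝ) c, f x = g0 x)
    (hfg1 : ∀ x ∈ Set.Icc c 1, f x = g1 x)
    (hjump : g0 c ≠ g1 c)
    (δ : ℝ) (hδ : 0 < δ) (hf2 : ∀ x ∈ Set.Icc (0:ℝ) 1, 2 + δ < f x) :
    Filter.limsup (fun n : ℕ => Dn f n / (Gf f) ^ n) atTop =
      ((1/2) * (f 1 + Real.sqrt (f 1 ^ 2 - 4)) /
          ((f 0 ^ 2 - 4) * (f 1 ^ 2 - 4)) ^ ((1:ℝ)/4)) *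
      ((g0 c - g1 c + Real.sqrt ((g1 c) ^ 2 - 4) + Real.sqrt ((g0 c) ^ 2 - 4)) /
          (2 * (((g1 c) ^ 2 - 4) * ((g0 c) ^ 2 - 4)) ^ ((1:ℝ)/4))) *
      max (((g1 c + Real.sqrt ((g1 c) ^ 2 - 4)) /
              (g0 c + Real.sqrt ((g0 c) ^ 2 - 4))) ^ ((1:ℝ) / (q : ℝ)))
          ((g1 c + Real.sqrt ((g1 c) ^ 2 - 4)) /
              (g0 c + Real.sqrt ((g0 c) ^ 2 - 4))) ∧
    Filter.liminf (fun n : ℕ => Dn f n / (Gf f) ^ n) atTop =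
      ((1/2) * (f 1 + Real.sqrt (f 1 ^ 2 - 4)) /
          ((f 0 ^ 2 - 4) * (f 1 ^ 2 - 4)) ^ ((1:ℝ)/4)) *
      ((g0 c - g1 c + Real.sqrt ((g1 c) ^ 2 - 4) + Real.sqrt ((g0 c) ^ 2 - 4)) /
          (2 * (((g1 c) ^ 2 - 4) * ((g0 c) ^ 2 - 4)) ^ ((1:ℝ)/4))) *
      min (((g1 c + Real.sqrt ((g1 c) ^ 2 - 4)) /
              (g0 c + Real.sqrt ((g0 c) ^ 2 - 4))) ^ ((1:ℝ) / (q : ℝ)))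
          ((g1 c + Real.sqrt ((g1 c) ^ 2 - 4)) /
              (g0 c + Real.sqrt ((g0 c) ^ 2 - 4))) := by
  have hq1 : 1 < q := by
    by_contra h
    have h1 : (q : ℝ) = 1 := by exact_mod_cast (by omega : q = 1)
    have h2 : (1 : ℝ) ≤ p := by exact_mod_cast hp
    rw [hc, h1, div_one] at hc1
    linarith
  have hg0 : ∀ x ∈ Set.Icc (0 : ℝ) c, 2 + δ ≤ g0 x := by
    have hcl : closure (Set.Ico 0 c) = Set.Icc 0 c := closure_Ico hc0.ne
    rw [← hcl]
    refine le_on_closure (fun x hx => ?_) continuousOn_const ?_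
    · rw [← hfg0 x hx]
      exact (hf2 x ⟨hx.1, hx.2.le.trans hc1.le⟩).le
    · rw [hcl]
      exact fun x hx => (hd01 x hx).continuousWithinAt
  have hg1 : ∀ x ∈ Set.Icc c 1, 2 + δ ≤ g1 x := by
    intro x hx
    rw [← hfg1 x hx]
    exact (hf2 x ⟨hc0.le.trans hx.1, hx.2⟩).le
  obtain ⟨φ0', L0, H0⟩ := exists_isSmoothBranch_logRoot hδ hd01 hd02 hbd0 hg0
  obtain ⟨φ1', L1, H1⟩ := exists_isSmoothBranch_logRoot hδ hd11 hd12 hbd1 hg1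
  have K0 := H0 (max (max L0 L1) 0) ((le_max_left _ _).trans (le_max_left _ _))
  have K1 := H1 (max (max L0 L1) 0) ((le_max_right _ _).trans (le_max_left _ _))
  have gt0 : ∀ x ∈ Set.Icc (0 : ℝ) c, 2 < g0 x := fun x hx => by linarith [hg0 x hx]
  have gt1 : ∀ x ∈ Set.Icc c 1, 2 < g1 x := fun x hx => by linarith [hg1 x hx]
  obtain ⟨hD, hlim⟩ := tendsto_log_Dn (f := f) K0 K1 (Real.log_pos (by linarith))
    (le_max_right _ _) hc0 hc1
    (fun x hx => (hfg0 x hx).trans (add_inv_exp_neg_logRoot (gt0 x (Set.Ico_subset_Icc_self hx))))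
    (fun x hx => (hfg1 x hx).trans (add_inv_exp_neg_logRoot (gt1 x hx)))
  have hG : Gf f = Real.exp ((∫ t in (0 : ℝ)..c, logRoot (g0 t)) +
      ∫ t in c..1, logRoot (g1 t)) := by
    have i0 : IntervalIntegrable (fun t => logRoot (g0 t)) MeasureTheory.volume 0 c :=
      (K0.continuousOn.mono (by rw [Set.uIcc_of_le hc0.le])).intervalIntegrable
    have i1 : IntervalIntegrable (fun t => logRoot (g1 t)) MeasureTheory.volume c 1 :=
      (K1.continuousOn.mono (by rw [Set.uIcc_of_le hc1.le])).intervalIntegrable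
    have e0 : Set.EqOn (fun t => logRoot (g0 t)) (fun t => logRoot (f t)) (Set.uIoo 0 c) := by
      rw [Set.uIoo_of_le hc0.le]
      intro t ht
      simp only [hfg0 t ⟨ht.1.le, ht.2⟩]
    have e1 : Set.EqOn (fun t => logRoot (g1 t)) (fun t => logRoot (f t)) (Set.uIoo c 1) := by
      rw [Set.uIoo_of_le hc1.le]
      intro t ht
      simp only [hfg1 t ⟨ht.1.le, ht.2.le⟩]
    rw [intervalIntegral.integral_congr_uIoo e0, intervalIntegral.integral_congr_uIoo e1,
      intervalIntegral.integral_add_adjacent_intervals (i0.congr_uIoo e0) (i1.congr_uIoo e1)]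
    rfl
  have c0 := gt0 c ⟨hc0.le, le_rfl⟩
  have c1 := gt1 c ⟨le_rfl, hc1.le⟩
  have hγ : (g1 c + Real.sqrt ((g1 c) ^ 2 - 4)) / (g0 c + Real.sqrt ((g0 c) ^ 2 - 4)) =
      Real.exp (logRoot (g1 c) - logRoot (g0 c)) := by
    rw [Real.exp_sub, exp_logRoot c0, exp_logRoot c1, div_div_div_cancel_right₀ two_ne_zero]
  rw [hγ, ← Real.exp_mul, mul_comm _ (1 / (q : ℝ)), hfg0 0 ⟨le_rfl, hc0⟩,
    hfg1 1 ⟨hc1.le, le_rfl⟩,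
    jump_constant_eq_exp (gt0 0 ⟨le_rfl, hc0.le⟩) (gt1 1 ⟨hc1.le, le_rfl⟩) c0 c1]
  set Δ := logRoot (g1 c) - logRoot (g0 c)
  obtain ⟨o1, o2, o3⟩ := rational_jump_offset hp hq1 hpq
  rw [← hc] at o1 o2 o3
  have heq : (fun n : ℕ => Dn f n / (Gf f) ^ n) =ᶠ[atTop] fun n : ℕ =>
      Real.exp (Real.log (Dn f n) - n * ((∫ t in (0 : ℝ)..c, logRoot (g0 t)) +
        ∫ t in c..1, logRoot (g1 t)) - (n * c - (⌈n * c⌉₊ - 1 : ℕ)) * Δ) *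
      Real.exp ((n * c - (⌈n * c⌉₊ - 1 : ℕ)) * Δ) := by
    filter_upwards [eventually_gt_atTop 0] with n hn
    rw [← Real.exp_add, sub_add_cancel, Real.exp_sub, Real.exp_log (hD n hn), hG,
      ← Real.exp_nat_mul]
  rw [limsup_congr heq, liminf_congr heq]
  have f1 : ∃ᶠ n : ℕ in atTop, Real.exp ((n * c - (⌈n * c⌉₊ - 1 : ℕ)) * Δ) =
      Real.exp (1 / q * Δ) := o2.mono fun n h => by rw [h]
  have f2 : ∃ᶠ n : ℕ in atTop, Real.exp ((n * c - (⌈n * c⌉₊ - 1 : ℕ)) * Δ) =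
      Real.exp Δ := o3.mono fun n h => by rw [h, one_mul]
  refine limsup_liminf_mul_eq (Real.exp_pos _) ((Real.continuous_exp.tendsto _).comp hlim) ?_ ?_ ?_
  · filter_upwards [eventually_gt_atTop 0] with n hn
    exact exp_mul_mem_Icc (o1 n hn).1 (o1 n hn).2
  · rcases min_choice (Real.exp (1 / q * Δ)) (Real.exp Δ) with h | h <;> rw [h] <;> assumption
  · rcases max_choice (Real.exp (1 / q * Δ)) (Real.exp Δ) with h | h <;> rw [h] <;> assumption
end
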